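/- arXiv:1704.07253 — 3 statements merged into one kernel-verified Lean document; each statement's English description precedes it below -/
import Mathlib

section
/- Suppose E ⊂ ℝ² is a Jordan domain whose curvature is bounded from above by a constant h > 0 in the viscosity sense. Then E contains an open ball of radius 1/h; that is, there exists x ∈ E with dist(x, ∂E) ≥ 1/h. -/
open MeasureTheory Metric Set ENNReal

def IsJordanCurve (Γ : Set (EuclideanSpace ℝ (Fin 2))) : Prop :=
  Nonempty (↥(Metric.sphere (0 : EuclideanSpace ℝ (Fin 2)) 1) ≃ₜ ↥Γ)

def IsJordanDomain (Ω : Set (EuclideanSpace ℝ (Fin 2))) : Prop :=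
  ∃ Γ : Set (EuclideanSpace ℝ (Fin 2)), IsJordanCurve Γ ∧ IsOpen Ω ∧
    Bornology.IsBounded Ω ∧ IsConnected Ω ∧ frontier Ω = Γ ∧
    ∀ x ∈ Ω, connectedComponentIn Γᶜ x = Ω

/-- `E` has curvature bounded above by `h` in the viscosity sense at the point `x ∈ ∂E`:
whenever a circular arc of `∂B_ρ(y)` locally touches `E` from outside at `x`
(i.e. `x ∈ ∂B_ρ(y)` and `E ∩ B_ε(x) ⊆ B̄_ρ(y)` for some `ε > 0`), then `ρ ≥ 1/h`. -/
def ViscCurvLEAt (E : Set (EuclideanSpace ℝ (Fin 2))) (h : ℝ) (x : EuclideanSpace ℝ (Fin 2)) :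
    Prop :=
  ∀ (y : EuclideanSpace ℝ (Fin 2)) (ρ : ℝ), 0 < ρ → x ∈ Metric.sphere y ρ →
    (∃ ε > 0, E ∩ Metric.ball x ε ⊆ Metric.closedBall y ρ) → 1 / h ≤ ρ

/-- `E` has curvature bounded above by `h` in the viscosity sense. -/
def ViscCurvLE (E : Set (EuclideanSpace ℝ (Fin 2))) (h : ℝ) : Prop :=
  ∀ x ∈ frontier E, ViscCurvLEAt E h x


/-- `NE K w`: the function `z - w` has a continuous logarithm on `K`, i.e. `K` does not enclose
the point `w`. -/
def NE (K : Set ℂ) (w : ℂ) : Prop :=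
  ∃ g : ℂ → ℂ, ContinuousOn g K ∧ ∀ z ∈ K, Complex.exp (g z) = z - w

theorem NE.mono {K K' : Set ℂ} {w : ℂ} (h : NE K w) (hK : K' ⊆ K) : NE K' w := by
  obtain ⟨g, hg, hg'⟩ := h
  exact ⟨g, hg.mono hK, fun z hz => hg' z (hK hz)⟩

theorem log_diff_const {X : Type*} [TopologicalSpace X] {S : Set X} (hS : IsPreconnected S)
    {g₁ g₂ : X → ℂ} (h₁ : ContinuousOn g₁ S) (h₂ : ContinuousOn g₂ S)
    (h : ∀ z ∈ S, Complex.exp (g₁ z) = Complex.exp (g₂ z)) {x y : X} (hx : x ∈ S) (hy : y ∈ S) :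
    g₁ x - g₂ x = g₁ y - g₂ y := by
  have key : ∀ z ∈ S, ∃ n : ℤ, g₁ z - g₂ z = n * (2 * Real.pi * Complex.I) := by
    intro z hz
    obtain ⟨n, hn⟩ := Complex.exp_eq_exp_iff_exists_int.1 (h z hz)
    exact ⟨n, by rw [hn]; ring⟩
  have hpi : (2 * Real.pi * Complex.I : ℂ) ≠ 0 := Complex.two_pi_I_ne_zero
  have hc : ContinuousOn (fun z => ((g₁ z - g₂ z) / (2 * Real.pi * Complex.I)).re) S := by
    have : ContinuousOn (fun z => (g₁ z - g₂ z) / (2 * Real.pi * Complex.I)) S :=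
      (h₁.sub h₂).div_const _
    exact Complex.continuous_re.comp_continuousOn this
  have hT : IsDiscrete (range ((↑) : ℤ → ℝ)) :=
    Int.isClosedEmbedding_coe_real.isEmbedding.isDiscrete_range
  have := hS.constant_of_mapsTo hT hc (by
    intro z hz
    obtain ⟨n, hn⟩ := key z hz
    refine ⟨n, ?_⟩
    simp only [hn]
    rw [mul_div_cancel_right₀ _ hpi]
    simp) hx hy
  obtain ⟨n, hn⟩ := key x hx
  obtain ⟨m, hm⟩ := key y hy
  simp only [hn, hm] at this
  rw [mul_div_cancel_right₀ _ hpi, mul_div_cancel_right₀ _ hpi] at this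
  simp only [Complex.intCast_re, Int.cast_inj] at this
  rw [hn, hm, this]

theorem NE.union {K₁ K₂ : Set ℂ} {w : ℂ} (h₁ : NE K₁ w) (h₂ : NE K₂ w) (c₁ : IsClosed K₁)
    (c₂ : IsClosed K₂) (hc : IsPreconnected (K₁ ∩ K₂)) : NE (K₁ ∪ K₂) w := by
  classical
  obtain ⟨g₁, hg₁, e₁⟩ := h₁
  obtain ⟨g₂, hg₂, e₂⟩ := h₂
  obtain ⟨c, hc1, hcc⟩ : ∃ c : ℂ, Complex.exp c = 1 ∧ ∀ z ∈ K₁ ∩ K₂, g₁ z = g₂ z + c := by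
    by_cases hne : (K₁ ∩ K₂).Nonempty
    · obtain ⟨x, hx⟩ := hne
      refine ⟨g₁ x - g₂ x, ?_, fun z hz => ?_⟩
      · rw [Complex.exp_sub, e₁ x hx.1, e₂ x hx.2, div_self]
        rw [← e₁ x hx.1]; exact Complex.exp_ne_zero _
      · have := log_diff_const hc (hg₁.mono inter_subset_left) (hg₂.mono inter_subset_right)
          (fun z hz => by rw [e₁ z hz.1, e₂ z hz.2]) hz hx
        rw [← this]; ring
    · exact ⟨0, by simp, fun z hz => (hne ⟨z, hz⟩).elim⟩
  refine ⟨fun z => if z ∈ K₁ then g₁ z else g₂ z + c, ?_, ?_⟩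
  · refine ContinuousOn.union_of_isClosed ?_ ?_ c₁ c₂
    · exact hg₁.congr fun z hz => by simp [hz]
    · refine (hg₂.add (continuousOn_const (c := c))).congr fun z hz => ?_
      by_cases h : z ∈ K₁
      · simp [h, hcc z ⟨h, hz⟩]
      · simp [h]
  · intro z hz
    by_cases h : z ∈ K₁
    · simp [h, e₁ z h]
    · simp [h, Complex.exp_add, hc1, e₂ z (hz.resolve_left h)]

theorem NE.of_near {K : Set ℂ} {w w' : ℂ} (h : NE K w) (hd : ∀ z ∈ K, dist w' w < dist z w) :
    NE K w' := by
  obtain ⟨g, hg, e⟩ := h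
  have hne : ∀ z ∈ K, z - w ≠ 0 := fun z hz => by rw [← e z hz]; exact Complex.exp_ne_zero _
  have hs : ∀ z ∈ K, 1 + -((w' - w) / (z - w)) ∈ Complex.slitPlane := by
    intro z hz
    apply Complex.mem_slitPlane_of_norm_lt_one
    rw [norm_neg, norm_div, div_lt_one (norm_pos_iff.2 (hne z hz))]
    have := hd z hz
    rwa [dist_eq_norm, dist_eq_norm] at this
  refine ⟨fun z => g z + Complex.log (1 + -((w' - w) / (z - w))), ?_, ?_⟩
  · refine hg.add (ContinuousOn.clog ?_ hs)
    refine continuousOn_const.add (ContinuousOn.neg (continuousOn_const.div ?_ hne))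
    fun_prop
  · intro z hz
    rw [Complex.exp_add, e z hz, Complex.exp_log (Complex.slitPlane_ne_zero (hs z hz))]
    have := hne z hz
    field_simp
    ring

theorem NE.of_far {K : Set ℂ} {w c : ℂ} {r : ℝ} (hK : K ⊆ closedBall c r)
    (hw : w ∉ closedBall c r) : NE K w := by
  rw [mem_closedBall, not_le, dist_comm, dist_eq_norm] at hw
  by_cases hr : K.Nonempty
  swap
  · rw [not_nonempty_iff_eq_empty] at hr
    exact ⟨0, by simp [hr]⟩
  obtain ⟨z0, hz0⟩ := hr
  have hcw : c - w ≠ 0 := by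
    intro h0
    rw [h0, norm_zero] at hw
    have := hK hz0
    rw [mem_closedBall] at this
    linarith [dist_nonneg (x := z0) (y := c)]
  have hs : ∀ z ∈ K, 1 + (z - c) / (c - w) ∈ Complex.slitPlane := by
    intro z hz
    apply Complex.mem_slitPlane_of_norm_lt_one
    rw [norm_div, div_lt_one (norm_pos_iff.2 hcw)]
    have := hK hz
    rw [mem_closedBall, dist_eq_norm] at this
    linarith
  refine ⟨fun z => Complex.log (c - w) + Complex.log (1 + (z - c) / (c - w)), ?_, ?_⟩
  · refine continuousOn_const.add (ContinuousOn.clog ?_ hs)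
    fun_prop
  · intro z hz
    rw [Complex.exp_add, Complex.exp_log hcw, Complex.exp_log (Complex.slitPlane_ne_zero (hs z hz))]
    field_simp
    ring

theorem NE.eventually {K : Set ℂ} {w : ℂ} (hK : IsClosed K) (hw : w ∉ K) :
    ∃ ε > 0, ball w ε ⊆ Kᶜ ∧ ∀ w' ∈ ball w ε, (NE K w ↔ NE K w') := by
  obtain ⟨ε, hε, hb⟩ := Metric.isOpen_iff.1 hK.isOpen_compl w hw
  have hfar : ∀ z ∈ K, ε ≤ dist z w := by
    intro z hz
    by_contra! hlt
    exact hb (mem_ball.2 hlt) hz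
  refine ⟨ε / 2, by positivity, (ball_subset_ball (by linarith)).trans hb, fun w' hw' => ?_⟩
  rw [mem_ball] at hw'
  constructor
  · intro h
    exact h.of_near fun z hz => by linarith [hfar z hz]
  · intro h
    refine h.of_near fun z hz => ?_
    have := hfar z hz
    have h3 := dist_triangle z w' w
    rw [dist_comm] at hw'
    rw [dist_comm w' w] at h3
    linarith

theorem NE.of_preconnected {K S : Set ℂ} {w w' : ℂ} (hK : IsClosed K) (hS : IsPreconnected S)
    (hSK : Disjoint S K) (hw : w ∈ S) (hw' : w' ∈ S) (h : NE K w) : NE K w' := by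
  by_contra hn
  have hSK' : ∀ x ∈ S, x ∉ K := fun x hx hx' => (Set.disjoint_left.1 hSK) hx hx'
  have o1 : IsOpen {x | x ∉ K ∧ NE K x} := by
    rw [Metric.isOpen_iff]
    rintro x ⟨hx, hx'⟩
    obtain ⟨ε, hε, hb, hh⟩ := NE.eventually hK hx
    exact ⟨ε, hε, fun y hy => ⟨hb hy, (hh y hy).1 hx'⟩⟩
  have o2 : IsOpen {x | x ∉ K ∧ ¬ NE K x} := by
    rw [Metric.isOpen_iff]
    rintro x ⟨hx, hx'⟩
    obtain ⟨ε, hε, hb, hh⟩ := NE.eventually hK hx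
    exact ⟨ε, hε, fun y hy => ⟨hb hy, fun h3 => hx' ((hh y hy).2 h3)⟩⟩
  obtain ⟨x, -, hx1, hx2⟩ := hS _ _ o1 o2
    (fun x hx => by
      by_cases hx' : NE K x
      · exact Or.inl ⟨hSK' x hx, hx'⟩
      · exact Or.inr ⟨hSK' x hx, hx'⟩)
    ⟨w, hw, hSK' w hw, h⟩ ⟨w', hw', hSK' w' hw', hn⟩
  exact hx2.2 hx1.2

theorem exists_log {X : Type*} [TopologicalSpace X] [SimplyConnectedSpace X]
    [LocallyPathConnectedSpace X] {f : X → ℂ} (hf : Continuous f) (h0 : ∀ x, f x ≠ 0) :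
    ∃ g : X → ℂ, Continuous g ∧ ∀ x, Complex.exp (g x) = f x := by
  obtain ⟨x₀⟩ : Nonempty X := inferInstance
  rcases Complex.isCoveringMapOn_exp.existsUnique_continuousMap_lifts
    ⟨f, hf⟩ (Complex.exp_log (h0 x₀)) (fun x => h0 x) with ⟨g, ⟨-, hg⟩, -⟩
  exact ⟨g, g.continuous, fun x => by simpa using congrFun hg x⟩

theorem not_NE_of_bounded {K E : Set ℂ} {w : ℂ} (hK : IsClosed K) (hE : IsOpen E)
    (hb : Bornology.IsBounded E) (hfr : frontier E ⊆ K) (hw : w ∈ E) : ¬ NE K w := by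
  classical
  rintro ⟨g, hg, e⟩
  obtain ⟨G, hG⟩ := ContinuousMap.exists_restrict_eq hK
    ⟨K.domRestrict g, continuousOn_iff_continuous_domRestrict.mp hg⟩
  have hG' : ∀ z ∈ K, G z = g z := fun z hz => by
    simpa using congrArg (fun f => f ⟨z, hz⟩) hG
  have hφ : Continuous (fun z => if z ∈ E then Complex.exp (G z) else z - w) := by
    refine Continuous.if ?_ (by fun_prop) (by fun_prop)
    intro a ha
    have ha' : a ∈ K := hfr ha
    rw [hG' a ha', e a ha']
  obtain ⟨H, hH, hH'⟩ := exists_log hφ (by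
    intro z
    split_ifs with hz
    · exact Complex.exp_ne_zero _
    · intro h0
      rw [sub_eq_zero.1 h0] at hz
      exact hz hw)
  obtain ⟨r, hr, hsub⟩ := hb.subset_ball_lt 0 w
  have hcirc : ∀ θ : ℝ, Complex.exp (H (w + r * Complex.exp (θ * Complex.I)))
      = Complex.exp (Real.log r + θ * Complex.I) := by
    intro θ
    have hnot : w + r * Complex.exp (θ * Complex.I) ∉ E := by
      intro h
      have := hsub h
      rw [mem_ball, dist_eq_norm] at this
      simp [Complex.norm_exp_ofReal_mul_I, abs_of_pos hr] at this
    rw [hH', if_neg hnot, Complex.exp_add, ← Complex.ofReal_exp, Real.exp_log hr]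
    ring
  have := log_diff_const (isPreconnected_univ (α := ℝ))
    (g₁ := fun θ : ℝ => H (w + r * Complex.exp (θ * Complex.I)))
    (g₂ := fun θ : ℝ => (Real.log r + θ * Complex.I : ℂ)) (by fun_prop) (by fun_prop)
    (fun θ _ => hcirc θ) (mem_univ 0) (mem_univ (2 * Real.pi))
  simp [Complex.exp_two_pi_mul_I] at this

theorem not_bounded_component {K : Set ℂ} {w : ℂ} (hK : IsClosed K) (hw : w ∉ K)
    (h : NE K w) : ¬ Bornology.IsBounded (connectedComponentIn Kᶜ w) := by
  intro hb
  have ho : IsOpen (connectedComponentIn Kᶜ w) := hK.isOpen_compl.connectedComponentIn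
  refine not_NE_of_bounded hK ho hb ?_ (mem_connectedComponentIn hw) h
  intro z hz
  by_contra hzK
  have ho' : IsOpen (connectedComponentIn Kᶜ z) := hK.isOpen_compl.connectedComponentIn
  rw [ho.frontier_eq] at hz
  obtain ⟨y, hy1, hy2⟩ := mem_closure_iff.1 hz.1 _ ho' (mem_connectedComponentIn hzK)
  apply hz.2
  have : connectedComponentIn Kᶜ w = connectedComponentIn Kᶜ z :=
    (connectedComponentIn_eq hy2).trans (connectedComponentIn_eq hy1).symm
  rw [this]
  exact mem_connectedComponentIn hzK

/-- A compact set `C` with a piece `B` removed that does not enclose `x ∈ B`: then some point of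
`B` is not enclosed by `C`. -/
theorem exists_NE_near {C B : Set ℂ} {x : ℂ} (hC : IsCompact C) (hB : IsOpen B) (hx : x ∈ B)
    (hBb : Bornology.IsBounded B) (h : NE (C \ B) x) : ∃ w ∈ B \ C, NE C w := by
  by_contra! hno
  have hcl : IsClosed (C \ B) := hC.isClosed.sdiff hB
  have hxn : x ∉ C \ B := fun h => h.2 hx
  have hunb := not_bounded_component hcl hxn h
  set W := connectedComponentIn (C \ B)ᶜ x with hW
  have hWc : ∀ y ∈ W, y ∉ C \ B := fun y hy => connectedComponentIn_subset _ _ hy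
  obtain ⟨r, hr⟩ := (hC.isBounded.union hBb).subset_closedBall x
  obtain ⟨y, hyW, hyr⟩ : ∃ y ∈ W, y ∉ closedBall x r := by
    by_contra! hcon
    exact hunb (isBounded_closedBall.subset hcon)
  have hyN : NE C y := NE.of_far (subset_union_left.trans hr) hyr
  have o1 : IsOpen (B ∪ {w | w ∉ C ∧ ¬ NE C w}) := by
    refine hB.union ?_
    rw [Metric.isOpen_iff]
    rintro x ⟨hx, hx'⟩
    obtain ⟨ε, hε, hb, hh⟩ := NE.eventually hC.isClosed hx
    exact ⟨ε, hε, fun y hy => ⟨hb hy, fun h3 => hx' ((hh y hy).2 h3)⟩⟩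
  have o2 : IsOpen {w | w ∉ C ∧ NE C w} := by
    rw [Metric.isOpen_iff]
    rintro x ⟨hx, hx'⟩
    obtain ⟨ε, hε, hb, hh⟩ := NE.eventually hC.isClosed hx
    exact ⟨ε, hε, fun y hy => ⟨hb hy, (hh y hy).1 hx'⟩⟩
  obtain ⟨z, -, hz1, hz2⟩ := isPreconnected_connectedComponentIn _ _ o1 o2
    (fun z hz => by
      have := hWc z hz
      by_cases hzB : z ∈ B
      · exact Or.inl (Or.inl hzB)
      · have hzC : z ∉ C := fun h => this ⟨h, hzB⟩
        by_cases hz' : NE C z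
        · exact Or.inr ⟨hzC, hz'⟩
        · exact Or.inl (Or.inr ⟨hzC, hz'⟩))
    ⟨x, mem_connectedComponentIn hxn, Or.inl hx⟩
    ⟨y, hyW, fun h => hyr (hr (Or.inl h)), hyN⟩
  rcases hz1 with hz1 | hz1
  · exact hno z ⟨hz1, hz2.1⟩ hz2.2
  · exact hz1.2 hz2.2

theorem NE_arc {γ : ℝ → ℂ} (hγ : Continuous γ) {s t : ℝ} (hinj : InjOn γ (Icc s t)) {w : ℂ}
    (hw : ∀ τ, γ τ ≠ w) : NE (γ '' Icc s t) w := by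
  obtain ⟨g, hg, hg'⟩ := exists_log (f := fun τ => γ τ - w) (by fun_prop)
    (fun τ => sub_ne_zero.2 (hw τ))
  refine ⟨g ∘ Function.invFunOn γ (Icc s t), ?_, ?_⟩
  · refine hg.comp_continuousOn ?_
    rw [continuousOn_iff_isClosed]
    intro F hF
    refine ⟨γ '' (Icc s t ∩ F), ((isCompact_Icc.inter_right hF).image hγ).isClosed, ?_⟩
    ext z
    constructor
    · rintro ⟨hz1, τ, hτ, rfl⟩
      exact ⟨⟨τ, ⟨hτ, by
        have := hinj.leftInvOn_invFunOn hτ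
        rw [mem_preimage, this] at hz1; exact hz1⟩, rfl⟩, τ, hτ, rfl⟩
    · rintro ⟨⟨τ, ⟨hτ, hF⟩, rfl⟩, -⟩
      refine ⟨?_, τ, hτ, rfl⟩
      rw [mem_preimage, hinj.leftInvOn_invFunOn hτ]; exact hF
  · rintro z ⟨τ, hτ, rfl⟩
    rw [Function.comp_apply, hinj.leftInvOn_invFunOn hτ, hg']

theorem mem_seg {x y c : ℂ} : c ∈ segment ℝ x y ↔
    ∃ θ : ℝ, 0 ≤ θ ∧ θ ≤ 1 ∧ c = x + θ * (y - x) := by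
  rw [segment_eq_image']
  constructor
  · rintro ⟨θ, hθ, rfl⟩
    exact ⟨θ, hθ.1, hθ.2, by simp⟩
  · rintro ⟨θ, h0, h1, rfl⟩
    exact ⟨θ, ⟨h0, h1⟩, by simp⟩

theorem isCompact_seg (x y : ℂ) : IsCompact (segment ℝ x y) := by
  rw [segment_eq_image']
  exact isCompact_Icc.image (by fun_prop)

theorem isPreconnected_seg (x y : ℂ) : IsPreconnected (segment ℝ x y) :=
  (convex_segment x y).isPreconnected

theorem subset_of_disjoint_frontier {S E : Set ℂ} (hS : IsPreconnected S) (hE : IsOpen E)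
    (hd : Disjoint S (frontier E)) {y : ℂ} (hy : y ∈ S) (hyE : y ∈ E) : S ⊆ E := by
  intro z hz
  by_contra hzE
  have hcov : ∀ w ∈ S, w ∉ E → w ∉ closure E := by
    intro w hw hwE hcl
    exact Set.disjoint_left.1 hd hw (by rw [hE.frontier_eq]; exact ⟨hcl, hwE⟩)
  obtain ⟨w, -, h1, h2⟩ := hS E (closure E)ᶜ hE isClosed_closure.isOpen_compl
    (fun w hw => by
      by_cases h : w ∈ E
      · exact Or.inl h
      · exact Or.inr (hcov w hw h)) ⟨y, hy, hyE⟩ ⟨z, hz, hcov z hz hzE⟩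
  exact h2 (subset_closure h1)

/-- `γ` is a `1`-periodic parametrization of the Jordan curve bounding `E`. -/
structure JD (γ : ℝ → ℂ) (E : Set ℂ) : Prop where
  cont : Continuous γ
  inj : ∀ s t, γ s = γ t ↔ ∃ k : ℤ, s = t + k
  opn : IsOpen E
  bdd : Bornology.IsBounded E
  fr : frontier E = range γ

/-- `γ τ` is a nearest point of the curve to `x`. -/
def Touch (γ : ℝ → ℂ) (x : ℂ) (τ : ℝ) : Prop := ∀ σ, dist x (γ τ) ≤ dist x (γ σ)

/-- The largest disc around `x` touches the curve at the distinct points `γ s`, `γ t`. -/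
structure Tri (γ : ℝ → ℂ) (E : Set ℂ) (x : ℂ) (s t : ℝ) : Prop where
  mem : x ∈ E
  lt : s < t
  lt' : t < s + 1
  ts : Touch γ x s
  tt : Touch γ x t

/-- the two radii -/
def LL (γ : ℝ → ℂ) (x : ℂ) (s t : ℝ) : Set ℂ := segment ℝ x (γ s) ∪ segment ℝ x (γ t)

/-- the arc closed up by the two radii -/
def CC (γ : ℝ → ℂ) (x : ℂ) (s t : ℝ) : Set ℂ := γ '' Icc s t ∪ LL γ x s t

theorem Touch.seg {γ : ℝ → ℂ} {x c : ℂ} {τ : ℝ} (h : Touch γ x τ) (hc : c ∈ segment ℝ x (γ τ)) :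
    Touch γ c τ := by
  intro σ
  have h1 := dist_add_dist_of_mem_segment hc
  have h2 := dist_triangle x c (γ σ)
  linarith [h σ]

theorem Touch.uniq {γ : ℝ → ℂ} {x c : ℂ} {τ σ : ℝ} (h : Touch γ x τ)
    (hc : c ∈ segment ℝ x (γ τ)) (hne : c ≠ x) (h' : Touch γ c σ) : γ σ = γ τ := by
  have h1 := dist_add_dist_of_mem_segment hc
  have h2 := dist_triangle x c (γ σ)
  have h3 := h σ
  have h4 := h.seg hc σ
  have h5 := h' τ
  have e1 : dist x c + dist c (γ σ) = dist x (γ σ) := by linarith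
  have e2 : dist x (γ σ) = dist x (γ τ) := by linarith
  have hc' : c ∈ segment ℝ x (γ σ) := by
    rw [mem_segment_iff_wbtw]
    exact dist_add_dist_eq_iff.1 e1
  obtain ⟨θ, h0, -, rfl⟩ := mem_seg.1 hc
  obtain ⟨θ', h0', -, e⟩ := mem_seg.1 hc'
  have e' : (θ : ℂ) * (γ τ - x) = θ' * (γ σ - x) := by linear_combination e
  have hn := congrArg norm e'
  rw [norm_mul, norm_mul, ← dist_eq_norm, ← dist_eq_norm, dist_comm _ x, dist_comm _ x, e2,
    Complex.norm_real, Complex.norm_real, Real.norm_of_nonneg h0, Real.norm_of_nonneg h0'] at hn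
  have hpos : dist x (γ τ) ≠ 0 := by
    intro hz
    apply hne
    rw [dist_eq_zero.1 hz]
    ring
  have hθ : θ = θ' := mul_right_cancel₀ hpos hn
  have hθ0 : (θ : ℂ) ≠ 0 := by
    intro hz
    apply hne
    rw [hz]; ring
  rw [← hθ] at e'
  have := mul_left_cancel₀ hθ0 e'
  linear_combination -this

namespace JD

variable {γ : ℝ → ℂ} {E : Set ℂ}

theorem notMem (J : JD γ E) (τ : ℝ) : γ τ ∉ E := by
  intro h
  have : γ τ ∈ frontier E := by rw [J.fr]; exact ⟨τ, rfl⟩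
  rw [J.opn.frontier_eq] at this
  exact this.2 h

theorem per (J : JD γ E) (τ : ℝ) : γ (τ + 1) = γ τ := (J.inj _ _).2 ⟨1, by simp⟩

theorem reduce (J : JD γ E) (s τ : ℝ) : ∃ τ' ∈ Ico s (s + 1), γ τ' = γ τ := by
  refine ⟨toIcoMod one_pos s τ, toIcoMod_mem_Ico _ _ _, ?_⟩
  rw [J.inj]
  refine ⟨- toIcoDiv one_pos s τ, ?_⟩
  rw [← self_sub_toIcoDiv_zsmul]
  simp
  ring

theorem inj' (J : JD γ E) {s t : ℝ} (h : γ s = γ t) (h1 : s < t + 1) (h2 : t < s + 1) :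
    s = t := by
  obtain ⟨k, hk⟩ := (J.inj _ _).1 h
  have a : (k : ℝ) < 1 := by linarith
  have b : (-1 : ℝ) < k := by linarith
  have a' : k < 1 := by exact_mod_cast a
  have b' : -1 < k := by exact_mod_cast b
  have : k = 0 := by omega
  rw [hk, this]; simp

theorem ball_sub (J : JD γ E) {y : ℂ} {τ : ℝ} (hy : y ∈ E) (h : Touch γ y τ) :
    ball y (dist y (γ τ)) ⊆ E := by
  have hpos : 0 < dist y (γ τ) := dist_pos.2 (fun e => J.notMem τ (e ▸ hy))
  refine subset_of_disjoint_frontier (convex_ball _ _).isPreconnected J.opn ?_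
    (mem_ball_self hpos) hy
  rw [Set.disjoint_right, J.fr]
  rintro _ ⟨σ, rfl⟩ hσ
  rw [mem_ball, dist_comm] at hσ
  linarith [h σ]

theorem seg_mem (J : JD γ E) {y c : ℂ} {τ : ℝ} (hy : y ∈ E) (h : Touch γ y τ)
    (hc : c ∈ segment ℝ y (γ τ)) (hne : c ≠ γ τ) : c ∈ E := by
  apply J.ball_sub hy h
  have h1 := dist_add_dist_of_mem_segment hc
  rw [mem_ball, dist_comm]
  have := dist_pos.2 hne
  linarith

/-- points of the curve on a touching radius -/
theorem seg_curve (J : JD γ E) {y : ℂ} {τ σ : ℝ} (hy : y ∈ E) (h : Touch γ y τ)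
    (hc : γ σ ∈ segment ℝ y (γ τ)) : γ σ = γ τ := by
  by_contra hne
  exact J.notMem σ (J.seg_mem hy h hc hne)

theorem swap (J : JD γ E) {x : ℂ} {s t : ℝ} (T : Tri γ E x s t) : Tri γ E x t (s + 1) where
  mem := T.mem
  lt := T.lt'
  lt' := by linarith [T.lt]
  ts := T.tt
  tt := by
    intro σ
    rw [J.per]
    exact T.ts σ

theorem LL_swap (J : JD γ E) (x : ℂ) (s t : ℝ) : LL γ x t (s + 1) = LL γ x s t := by
  rw [LL, LL, J.per, union_comm]

theorem ne (J : JD γ E) {x : ℂ} {s t : ℝ} (T : Tri γ E x s t) : γ s ≠ γ t := by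
  intro h
  have := J.inj' h (by linarith [T.lt]) T.lt'
  linarith [T.lt]

theorem Rpos (J : JD γ E) {x : ℂ} (hx : x ∈ E) (τ : ℝ) : 0 < dist x (γ τ) :=
  dist_pos.2 (fun e => J.notMem τ (e ▸ hx))

theorem LL_touch {x c : ℂ} {s t : ℝ} (T : Tri γ E x s t) (hc : c ∈ LL γ x s t) :
    Touch γ c s ∨ Touch γ c t := by
  rcases hc with hc | hc
  · exact Or.inl (T.ts.seg hc)
  · exact Or.inr (T.tt.seg hc)

theorem LL_curve (J : JD γ E) {x : ℂ} {s t σ : ℝ} (T : Tri γ E x s t) (hc : γ σ ∈ LL γ x s t) :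
    γ σ = γ s ∨ γ σ = γ t := by
  rcases hc with hc | hc
  · exact Or.inl (J.seg_curve T.mem T.ts hc)
  · exact Or.inr (J.seg_curve T.mem T.tt hc)

theorem isCompact_arc (J : JD γ E) (s t : ℝ) : IsCompact (γ '' Icc s t) :=
  isCompact_Icc.image J.cont

theorem isCompact_LL (x : ℂ) (s t : ℝ) : IsCompact (LL γ x s t) :=
  (isCompact_seg _ _).union (isCompact_seg _ _)

theorem isCompact_CC (J : JD γ E) (x : ℂ) (s t : ℝ) : IsCompact (CC γ x s t) :=
  (J.isCompact_arc s t).union (isCompact_LL _ _ _)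

theorem injOn (J : JD γ E) {s t : ℝ} (h : t < s + 1) : InjOn γ (Icc s t) := by
  intro a ha b hb hab
  exact J.inj' hab (by linarith [ha.1, ha.2, hb.1, hb.2]) (by linarith [ha.1, ha.2, hb.1, hb.2])

theorem dist_eq {x : ℂ} {s t : ℝ} (T : Tri γ E x s t) : dist x (γ s) = dist x (γ t) :=
  le_antisymm (T.ts t) (T.tt s)

/-- Lemma A: some point near `x` is not enclosed by `CC`. -/
theorem exists_NE (J : JD γ E) {x : ℂ} {s t : ℝ} (T : Tri γ E x s t) :
    ∃ w ∈ ball x (dist x (γ s)) \ CC γ x s t, NE (CC γ x s t) w := by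
  set R := dist x (γ s) with hR
  have hRt : dist x (γ t) = R := (dist_eq T).symm
  have hRpos : 0 < R := J.Rpos T.mem s
  have key : NE (CC γ x s t \ ball x (R / 2)) x := by
    set Kp := segment ℝ x (γ s) \ ball x (R / 2) with hKp
    set Kq := segment ℝ x (γ t) \ ball x (R / 2) with hKq
    have cp : IsClosed Kp := (isCompact_seg _ _).isClosed.sdiff isOpen_ball
    have cq : IsClosed Kq := (isCompact_seg _ _).isClosed.sdiff isOpen_ball
    have cΓ : IsClosed (γ '' Icc s t) := (J.isCompact_arc s t).isClosed
    have nΓ : NE (γ '' Icc s t) x :=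
      NE_arc J.cont (J.injOn T.lt') (fun τ e => J.notMem τ (e ▸ T.mem))
    have np : NE Kp x := by
      refine NE.of_far (c := γ s) (r := R / 2) ?_ ?_
      · rintro z ⟨hz, hz'⟩
        have := dist_add_dist_of_mem_segment hz
        rw [mem_ball, dist_comm] at hz'
        rw [mem_closedBall]
        linarith
      · rw [mem_closedBall]; linarith
    have nq : NE Kq x := by
      refine NE.of_far (c := γ t) (r := R / 2) ?_ ?_
      · rintro z ⟨hz, hz'⟩
        have := dist_add_dist_of_mem_segment hz
        rw [mem_ball, dist_comm] at hz'
        rw [mem_closedBall]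
        linarith
      · rw [mem_closedBall]; linarith
    have n1 : NE (γ '' Icc s t ∪ Kp) x := by
      refine nΓ.union np cΓ cp (Set.Subsingleton.isPreconnected ?_)
      have : ∀ z ∈ γ '' Icc s t ∩ Kp, z = γ s := by
        rintro _ ⟨⟨τ, -, rfl⟩, hz, -⟩
        exact J.seg_curve T.mem T.ts hz
      intro a ha b hb
      rw [this a ha, this b hb]
    have n2 : NE ((γ '' Icc s t ∪ Kp) ∪ Kq) x := by
      refine n1.union nq (cΓ.union cp) cq (Set.Subsingleton.isPreconnected ?_)
      have : ∀ z ∈ (γ '' Icc s t ∪ Kp) ∩ Kq, z = γ t := by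
        rintro z ⟨hz1 | hz1, hz2, hz3⟩
        · obtain ⟨τ, -, rfl⟩ := hz1
          exact J.seg_curve T.mem T.tt hz2
        · exfalso
          refine J.ne T (T.tt.uniq hz2 ?_ (T.ts.seg hz1.1))
          rintro rfl
          exact hz3 (mem_ball_self (by positivity))
      intro a ha b hb
      rw [this a ha, this b hb]
    refine n2.mono ?_
    rintro z ⟨hz | hz | hz, hz'⟩
    · exact Or.inl (Or.inl hz)
    · exact Or.inl (Or.inr ⟨hz, hz'⟩)
    · exact Or.inr ⟨hz, hz'⟩
  obtain ⟨w, hw, hN⟩ := exists_NE_near (J.isCompact_CC x s t) isOpen_ball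
    (mem_ball_self (by positivity)) isBounded_ball key
  exact ⟨w, ⟨ball_subset_ball (by linarith) hw.1, hw.2⟩, hN⟩

theorem arc_notMem_CC (J : JD γ E) {x : ℂ} {s t τ : ℝ} (T : Tri γ E x s t)
    (hτ : τ ∈ Ioo t (s + 1)) : γ τ ∉ CC γ x s t := by
  rintro (⟨σ, hσ, e⟩ | h)
  · have := J.inj' e (by linarith [hσ.1, hσ.2, hτ.1, hτ.2]) (by linarith [hσ.1, hσ.2, hτ.1, hτ.2])
    linarith [hσ.1, hσ.2, hτ.1, hτ.2]
  · have := T.lt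
    rcases J.LL_curve T h with e | e
    · have := J.inj' e (by linarith [hτ.1, hτ.2]) (by linarith [hτ.1, hτ.2])
      linarith [hτ.1, hτ.2]
    · have := J.inj' e (by linarith [hτ.1, hτ.2]) (by linarith [hτ.1, hτ.2])
      linarith [hτ.1, hτ.2]

/-- Lemma B: the complementary open arc is not enclosed by `CC`. -/
theorem NE_arc_compl (J : JD γ E) {x : ℂ} {s t τ : ℝ} (T : Tri γ E x s t)
    (hτ : τ ∈ Ioo t (s + 1)) : NE (CC γ x s t) (γ τ) := by
  by_contra hno
  have hcl := (J.isCompact_CC x s t).isClosed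
  have hall : ∀ σ ∈ Ioo t (s + 1), ¬ NE (CC γ x s t) (γ σ) := by
    intro σ hσ hN
    refine hno (NE.of_preconnected hcl (S := γ '' Ioo t (s + 1))
      (isPreconnected_Ioo.image _ J.cont.continuousOn) ?_ ⟨σ, hσ, rfl⟩ ⟨τ, hτ, rfl⟩ hN)
    rw [Set.disjoint_left]
    rintro _ ⟨σ', hσ', rfl⟩
    exact J.arc_notMem_CC T hσ'
  obtain ⟨w, ⟨hwb, hwC⟩, hwN⟩ := J.exists_NE T
  have hwE : w ∈ E := J.ball_sub T.mem T.ts hwb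
  refine not_bounded_component hcl hwC hwN (J.bdd.subset ?_)
  refine subset_of_disjoint_frontier isPreconnected_connectedComponentIn J.opn ?_
    (mem_connectedComponentIn hwC) hwE
  rw [Set.disjoint_right, J.fr]
  rintro _ ⟨σ, rfl⟩ hσ
  have hσC : γ σ ∉ CC γ x s t := connectedComponentIn_subset _ _ hσ
  obtain ⟨σ', hσ', e⟩ := J.reduce s σ
  rw [← e] at hσ hσC
  have hlt : t < σ' := by
    by_contra! hle
    exact hσC (Or.inl ⟨σ', ⟨hσ'.1, hle⟩, rfl⟩)
  refine hall σ' ⟨hlt, hσ'.2⟩ (NE.of_preconnected hcl isPreconnected_connectedComponentIn ?_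
    (mem_connectedComponentIn hwC) hσ hwN)
  rw [Set.disjoint_left]
  intro z hz
  exact connectedComponentIn_subset _ _ hz

theorem isPreconnected_LL (x : ℂ) (s t : ℝ) : IsPreconnected (LL γ x s t) :=
  (isPreconnected_seg _ _).union x (left_mem_segment _ _ _) (left_mem_segment _ _ _)
    (isPreconnected_seg _ _)

/-- Lemma P: a point of `E` is enclosed by one of the two closed curves. -/
theorem not_both (J : JD γ E) {x y : ℂ} {s t : ℝ} (T : Tri γ E x s t) (hy : y ∈ E)
    (h1 : NE (CC γ x s t) y) (h2 : NE (CC γ x t (s + 1)) y) : False := by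
  have hcl1 := (J.isCompact_CC x s t).isClosed
  have hcl2 := (J.isCompact_CC x t (s + 1)).isClosed
  have hint : CC γ x s t ∩ CC γ x t (s + 1) = LL γ x s t := by
    rw [CC, CC, J.LL_swap, ← inter_union_distrib_right, union_eq_right]
    rintro z ⟨⟨σ, hσ, rfl⟩, ⟨τ, hτ, e⟩⟩
    by_cases hτ1 : τ = s + 1
    · left
      rw [← e, hτ1, J.per]
      exact right_mem_segment _ _ _
    · have hτ2 : τ < s + 1 := lt_of_le_of_ne hτ.2 hτ1
      have := J.inj' e (by linarith [hσ.1, hσ.2, hτ.1]) (by linarith [hσ.1, hσ.2, hτ.1])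
      have : σ = t := by linarith [hσ.1, hσ.2, hτ.1]
      rw [this]
      exact Or.inr (right_mem_segment _ _ _)
  have h3 := h1.union h2 hcl1 hcl2 (by rw [hint]; exact isPreconnected_LL _ _ _)
  refine not_NE_of_bounded (hcl1.union hcl2) J.opn J.bdd ?_ hy h3
  rw [J.fr]
  rintro _ ⟨σ, rfl⟩
  obtain ⟨σ', hσ', e⟩ := J.reduce s σ
  rw [← e]
  rcases le_total σ' t with h | h
  · exact Or.inl (Or.inl ⟨σ', ⟨hσ'.1, h⟩, rfl⟩)
  · exact Or.inr (Or.inl ⟨σ', ⟨h, hσ'.2.le⟩, rfl⟩)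

/-- Lemma N: nearest points of points enclosed by `CC` lie on the arc. -/
theorem nearest_mem (J : JD γ E) {x y : ℂ} {s t τ : ℝ} (T : Tri γ E x s t) (hy : y ∈ E)
    (hyL : y ∉ LL γ x s t) (hN : ¬ NE (CC γ x s t) y) (h : Touch γ y τ) :
    ∃ σ ∈ Icc s t, γ σ = γ τ := by
  obtain ⟨σ, hσ, e⟩ := J.reduce s τ
  refine ⟨σ, ⟨hσ.1, ?_⟩, e⟩
  by_contra! hlt
  have hσ' : σ ∈ Ioo t (s + 1) := ⟨hlt, hσ.2⟩
  have hT : Touch γ y σ := by intro u; rw [e]; exact h u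
  have hnC := J.arc_notMem_CC T hσ'
  refine hN (NE.of_preconnected (J.isCompact_CC x s t).isClosed (isPreconnected_seg y (γ σ)) ?_
    (right_mem_segment _ _ _) (left_mem_segment _ _ _) (J.NE_arc_compl T hσ'))
  rw [Set.disjoint_left]
  intro c hc hcC
  have hcne : c ≠ γ σ := by rintro rfl; exact hnC hcC
  have hcE := J.seg_mem hy hT hc hcne
  rcases hcC with ⟨u, -, rfl⟩ | hcL
  · exact J.notMem u hcE
  · have hcy : c ≠ y := by rintro rfl; exact hyL hcL
    rcases LL_touch T hcL with h1 | h1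
    · refine hnC (Or.inr (Or.inl ?_))
      rw [← hT.uniq hc hcy h1]
      exact right_mem_segment _ _ _
    · refine hnC (Or.inr (Or.inr ?_))
      rw [← hT.uniq hc hcy h1]
      exact right_mem_segment _ _ _

/-- (F): a short arc is touched from outside by a ball centred at `x`. -/
theorem short_arc (J : JD γ E) {x : ℂ} {s t ρ₀ : ℝ} (T : Tri γ E x s t)
    (hcurv : ∀ z ∈ frontier E, ∀ (y : ℂ) (ρ : ℝ), 0 < ρ → z ∈ sphere y ρ →
      (∃ ε > 0, E ∩ ball z ε ⊆ closedBall y ρ) → ρ₀ ≤ ρ)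
    (hsub : ∀ τ ∈ Icc s t, dist x (γ τ) < ρ₀) : False := by
  have hcd : Continuous (fun τ => dist x (γ τ)) := continuous_const.dist J.cont
  obtain ⟨τ, hτ, hmax⟩ : ∃ τ ∈ Ioo s t, ∀ σ ∈ Icc s t, dist x (γ σ) ≤ dist x (γ τ) := by
    obtain ⟨τ, hτ, hm⟩ := isCompact_Icc.exists_isMaxOn (nonempty_Icc.2 T.lt.le) hcd.continuousOn
    have hm' : ∀ σ ∈ Icc s t, dist x (γ σ) ≤ dist x (γ τ) := fun σ hσ => hm hσ
    have hlt := T.lt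
    by_cases h1 : τ = s
    · refine ⟨(s + t) / 2, ⟨by linarith, by linarith⟩, fun σ hσ => (hm' σ hσ).trans ?_⟩
      rw [h1]; exact T.ts _
    · by_cases h2 : τ = t
      · refine ⟨(s + t) / 2, ⟨by linarith, by linarith⟩, fun σ hσ => (hm' σ hσ).trans ?_⟩
        rw [h2]; exact T.tt _
      · exact ⟨τ, ⟨lt_of_le_of_ne hτ.1 (Ne.symm h1), lt_of_le_of_ne hτ.2 h2⟩, hm'⟩
  have hτN : NE (CC γ x t (s + 1)) (γ (τ + 1)) :=
    J.NE_arc_compl (J.swap T) ⟨by linarith [hτ.1], by linarith [hτ.2]⟩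
  have hτn : γ (τ + 1) ∉ CC γ x t (s + 1) :=
    J.arc_notMem_CC (J.swap T) ⟨by linarith [hτ.1], by linarith [hτ.2]⟩
  rw [J.per] at hτN hτn
  obtain ⟨ε, hε, -, hh⟩ := NE.eventually (J.isCompact_CC x t (s + 1)).isClosed hτn
  have := hcurv (γ τ) (by rw [J.fr]; exact ⟨τ, rfl⟩) x (dist x (γ τ)) (J.Rpos T.mem τ)
    (by rw [mem_sphere, dist_comm]) ⟨ε, hε, ?_⟩
  · linarith [hsub τ ⟨hτ.1.le, hτ.2.le⟩]
  rintro w ⟨hwE, hwb⟩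
  by_contra hw
  refine J.not_both T hwE (NE.of_far ?_ hw) ((hh w hwb).1 hτN)
  rintro z (⟨σ, hσ, rfl⟩ | hz | hz)
  · rw [mem_closedBall, dist_comm]; exact hmax σ hσ
  · have := dist_add_dist_of_mem_segment hz
    rw [mem_closedBall, dist_comm]
    linarith [T.ts τ, dist_nonneg (x := z) (y := γ s)]
  · have := dist_add_dist_of_mem_segment hz
    rw [mem_closedBall, dist_comm]
    linarith [T.tt τ, dist_nonneg (x := z) (y := γ t)]

end JD

/-- A point on the axis of a kite is enclosed by the kite. -/
theorem kite_encloses {K : Set ℂ} (hK : IsClosed K) {x u : ℂ} (hu : u ≠ 0) {k c b r : ℝ}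
    (hc : c ≠ 0) (hr : 0 < r) (hrb : r < b)
    (h1 : segment ℝ x (x + u * (k + c * Complex.I)) ⊆ K)
    (h2 : segment ℝ x (x + u * (k - c * Complex.I)) ⊆ K)
    (h3 : segment ℝ (x + u * b) (x + u * (k + c * Complex.I)) ⊆ K)
    (h4 : segment ℝ (x + u * b) (x + u * (k - c * Complex.I)) ⊆ K) : ¬ NE K (x + u * r) := by
  set Z : ℂ → ℂ := fun z => (z - x) / u with hZ
  have hZc : Continuous Z := by fun_prop
  have hzZ : ∀ z, z = x + u * Z z := fun z => by simp only [hZ]; field_simp; ring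
  set f1 : ℂ → ℝ := fun z => k * |(Z z).im / c| - (Z z).re with hf1
  set f2 : ℂ → ℝ := fun z => (Z z).re - (1 - |(Z z).im / c|) * b - |(Z z).im / c| * k with hf2
  have hf1c : Continuous f1 := by fun_prop
  have hf2c : Continuous f2 := by fun_prop
  set D : Set ℂ := {z | f1 z < 0 ∧ f2 z < 0} with hD
  have hDo : IsOpen D := (isOpen_lt hf1c continuous_const).inter (isOpen_lt hf2c continuous_const)
  have hb : 0 < b := hr.trans hrb
  have hclo : ∀ z ∈ closure D, f1 z ≤ 0 ∧ f2 z ≤ 0 := by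
    intro z hz
    have hcl : IsClosed {z | f1 z ≤ 0 ∧ f2 z ≤ 0} :=
      (isClosed_le hf1c continuous_const).inter (isClosed_le hf2c continuous_const)
    exact closure_minimal (show D ⊆ {z | f1 z ≤ 0 ∧ f2 z ≤ 0} from
      fun z hz => ⟨hz.1.le, hz.2.le⟩) hcl hz
  have hψ : ∀ z, f1 z ≤ 0 → f2 z ≤ 0 → |(Z z).im / c| ≤ 1 := by
    intro z a1 a2
    simp only [hf1, hf2] at a1 a2
    nlinarith
  have hDb : Bornology.IsBounded D := by
    refine (isBounded_closedBall (x := x) (r := ‖u‖ * (|k| + b + |c|))).subset ?_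
    intro z hz
    have a := hψ z hz.1.le hz.2.le
    have a1 := hz.1
    have a2 := hz.2
    simp only [hf1, hf2] at a1 a2
    rw [mem_closedBall, dist_eq_norm]
    have e : z - x = u * Z z := by linear_combination hzZ z
    rw [e, norm_mul]
    refine mul_le_mul_of_nonneg_left ?_ (norm_nonneg _)
    refine (Complex.norm_le_abs_re_add_abs_im _).trans ?_
    have b1 : |(Z z).im| ≤ |c| := by
      rwa [abs_div, div_le_one (abs_pos.2 hc)] at a
    have b0 := abs_nonneg ((Z z).im / c)
    have b2 : |(Z z).re| ≤ |k| + b := by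
      rw [abs_le]
      have := neg_abs_le k
      have := le_abs_self k
      constructor <;> nlinarith
    linarith
  refine not_NE_of_bounded hK hDo hDb ?_ ?_
  · intro z hz
    rw [hDo.frontier_eq] at hz
    obtain ⟨a1, a2⟩ := hclo z hz.1
    have a := hψ z a1 a2
    have hor : f1 z = 0 ∨ f2 z = 0 := by
      by_contra! hcon
      exact hz.2 ⟨lt_of_le_of_ne a1 hcon.1, lt_of_le_of_ne a2 hcon.2⟩
    have him : (Z z).im = c * ((Z z).im / c) := by field_simp
    have hZe : Z z = (Z z).re + (Z z).im * Complex.I := (Complex.re_add_im _).symm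
    set ψ := (Z z).im / c with hψd
    rcases hor with h0 | h0
    · simp only [hf1] at h0
      have hre : (Z z).re = k * |ψ| := by linarith
      rcases le_total 0 ψ with hs | hs
      · apply h1
        rw [abs_of_nonneg hs] at hre a
        refine mem_seg.2 ⟨ψ, hs, a, ?_⟩
        rw [hzZ z, hZe, him, hre]; push_cast; ring
      · apply h2
        rw [abs_of_nonpos hs] at hre a
        refine mem_seg.2 ⟨-ψ, by linarith, a, ?_⟩
        rw [hzZ z, hZe, him, hre]; push_cast; ring
    · simp only [hf2] at h0
      have hre : (Z z).re = (1 - |ψ|) * b + |ψ| * k := by linarith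
      rcases le_total 0 ψ with hs | hs
      · apply h3
        rw [abs_of_nonneg hs] at hre a
        refine mem_seg.2 ⟨ψ, hs, a, ?_⟩
        rw [hzZ z, hZe, him, hre]; push_cast; ring
      · apply h4
        rw [abs_of_nonpos hs] at hre a
        refine mem_seg.2 ⟨-ψ, by linarith, a, ?_⟩
        rw [hzZ z, hZe, him, hre]; push_cast; ring
  · have e : Z (x + u * r) = r := by simp only [hZ]; field_simp; ring
    constructor
    · simp [hf1, e, hr]
    · simp [hf2, e, hrb]

namespace JD

variable {γ : ℝ → ℂ} {E : Set ℂ}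

theorem kite (J : JD γ E) {x β u : ℂ} {s t k c b r₁ r₂ : ℝ} (Tx : Tri γ E x s t)
    (Tβ : Tri γ E β s t) (hu : ‖u‖ = 1) (hc : c ≠ 0) (hb : 0 < b)
    (hp : γ s = x + u * (k + c * Complex.I)) (hq : γ t = x + u * (k - c * Complex.I))
    (hβ : β = x + u * b) (h1 : 0 < r₁) (h1' : r₁ < b) (h2 : 0 < r₂) (h2' : r₂ < b)
    (N1 : NE (CC γ x t (s + 1)) (x + u * r₁)) (N2 : NE (CC γ β t (s + 1)) (x + u * r₂)) :
    False := by
  have hu0 : u ≠ 0 := by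
    rintro rfl; simp at hu
  have key : ∀ z z' : ℂ, x + u * z = x + u * z' → z = z' := by
    intro z z' h
    exact mul_left_cancel₀ hu0 (add_left_cancel h)
  set S : Set ℂ := (fun r : ℝ => x + u * r) '' Ioo 0 b with hS
  have hSp : IsPreconnected S := isPreconnected_Ioo.image _ (by fun_prop)
  have hSE : S ⊆ E := by
    rintro _ ⟨r, hr, rfl⟩
    have e1 : dist x (γ s) = ‖(k + c * Complex.I : ℂ)‖ := by
      rw [dist_comm, dist_eq_norm, hp, add_sub_cancel_left, norm_mul, hu, one_mul]
    have e2 : dist β (γ s) = ‖((k - b : ℝ) + c * Complex.I : ℂ)‖ := by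
      rw [dist_comm, dist_eq_norm, hp, hβ]
      rw [show x + u * (k + c * Complex.I) - (x + u * b) = u * ((k - b : ℝ) + c * Complex.I) by
        push_cast; ring, norm_mul, hu, one_mul]
    have f1 : |k| < dist x (γ s) := by
      rw [e1]
      have := Complex.abs_re_lt_norm (z := (k + c * Complex.I : ℂ))
      simp only [Complex.add_re, Complex.ofReal_re, Complex.mul_re, Complex.I_re, mul_zero,
        Complex.ofReal_im, Complex.I_im, mul_one, sub_self, add_zero, Complex.add_im,
        Complex.mul_im, zero_add] at this
      exact this.2 hc
    have f2 : |k - b| < dist β (γ s) := by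
      rw [e2]
      have := Complex.abs_re_lt_norm (z := ((k - b : ℝ) + c * Complex.I : ℂ))
      simp only [Complex.add_re, Complex.ofReal_re, Complex.mul_re, Complex.I_re, mul_zero,
        Complex.ofReal_im, Complex.I_im, mul_one, sub_self, add_zero, Complex.add_im,
        Complex.mul_im, zero_add] at this
      exact this.2 hc
    have g1 : dist (x + u * r) x = r := by
      rw [dist_eq_norm, add_sub_cancel_left, norm_mul, hu, one_mul, Complex.norm_real,
        Real.norm_of_nonneg hr.1.le]
    have g2 : dist (x + u * r) β = b - r := by
      rw [dist_eq_norm, hβ, show x + u * r - (x + u * b) = u * ((r - b : ℝ) : ℂ) by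
        push_cast; ring, norm_mul, hu, one_mul, Complex.norm_real, Real.norm_of_nonpos
        (by linarith [hr.2])]
      ring
    by_cases hcase : r < dist x (γ s)
    · exact J.ball_sub Tx.mem Tx.ts (by rw [mem_ball, g1]; exact hcase)
    · refine J.ball_sub Tβ.mem Tβ.ts ?_
      rw [mem_ball, g2]
      have := le_abs_self k
      have := neg_abs_le (k - b)
      linarith
  have hSx : Disjoint S (CC γ x t (s + 1)) := by
    rw [Set.disjoint_left]
    rintro z hz (⟨τ, -, rfl⟩ | hL)
    · exact J.notMem τ (hSE hz)
    · rw [J.LL_swap] at hL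
      obtain ⟨r, hr, rfl⟩ := hz
      rcases hL with hL | hL
      · obtain ⟨θ, -, -, e⟩ := mem_seg.1 hL
        rw [hp] at e
        have e' := key r (θ * (k + c * Complex.I)) (e.trans (by ring))
        have ei := congrArg Complex.im e'
        have er := congrArg Complex.re e'
        simp at ei er
        rcases ei with ei | ei
        · rw [ei] at er; simp at er; linarith [hr.1]
        · exact hc ei
      · obtain ⟨θ, -, -, e⟩ := mem_seg.1 hL
        rw [hq] at e
        have e' := key r (θ * (k - c * Complex.I)) (e.trans (by ring))
        have ei := congrArg Complex.im e'
        have er := congrArg Complex.re e'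
        simp at ei er
        rcases ei with ei | ei
        · rw [ei] at er; simp at er; linarith [hr.1]
        · exact hc ei
  have hSβ : Disjoint S (CC γ β t (s + 1)) := by
    rw [Set.disjoint_left]
    rintro z hz (⟨τ, -, rfl⟩ | hL)
    · exact J.notMem τ (hSE hz)
    · rw [J.LL_swap] at hL
      obtain ⟨r, hr, rfl⟩ := hz
      rcases hL with hL | hL
      · obtain ⟨θ, -, -, e⟩ := mem_seg.1 hL
        rw [hp, hβ] at e
        have e' := key r (b + θ * (k - b + c * Complex.I)) (e.trans (by ring))
        have ei := congrArg Complex.im e'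
        have er := congrArg Complex.re e'
        simp at ei er
        rcases ei with ei | ei
        · rw [ei] at er; simp at er; linarith [hr.2]
        · exact hc ei
      · obtain ⟨θ, -, -, e⟩ := mem_seg.1 hL
        rw [hq, hβ] at e
        have e' := key r (b + θ * (k - b - c * Complex.I)) (e.trans (by ring))
        have ei := congrArg Complex.im e'
        have er := congrArg Complex.re e'
        simp at ei er
        rcases ei with ei | ei
        · rw [ei] at er; simp at er; linarith [hr.2]
        · exact hc ei
  have hcx := (J.isCompact_CC x t (s + 1)).isClosed
  have hcβ := (J.isCompact_CC β t (s + 1)).isClosed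
  have N2' : NE (CC γ β t (s + 1)) (x + u * r₁) :=
    NE.of_preconnected hcβ hSp hSβ ⟨r₂, ⟨h2, h2'⟩, rfl⟩ ⟨r₁, ⟨h1, h1'⟩, rfl⟩ N2
  have hxβ : x ≠ β := by
    rw [hβ]; intro h
    have : u * (b : ℂ) = 0 := by linear_combination -h
    rcases mul_eq_zero.1 this with h | h
    · exact hu0 h
    · rw [Complex.ofReal_eq_zero] at h; exact hb.ne' h
  have hend : ∀ z, (z = γ s ∨ z = γ t) → z ∈ γ '' Icc t (s + 1) := by
    rintro z (rfl | rfl)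
    · exact ⟨s + 1, ⟨Tx.lt'.le, le_rfl⟩, J.per s⟩
    · exact ⟨t, ⟨le_rfl, Tx.lt'.le⟩, rfl⟩
  have hint : CC γ x t (s + 1) ∩ CC γ β t (s + 1) = γ '' Icc t (s + 1) := by
    rw [CC, CC, ← union_inter_distrib_left, union_eq_left, J.LL_swap, J.LL_swap]
    rintro z ⟨hz1, hz2⟩
    apply hend
    rcases hz1 with hz1 | hz1 <;> rcases hz2 with hz2 | hz2
    · left
      obtain ⟨θ, -, -, e⟩ := mem_seg.1 hz1
      obtain ⟨θ', -, -, e'⟩ := mem_seg.1 hz2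
      rw [hp] at e
      rw [hp, hβ] at e'
      have e3 := key (θ * (k + c * Complex.I)) (b + θ' * (k - b + c * Complex.I))
        (by linear_combination e' - e)
      have ei := congrArg Complex.im e3
      have er := congrArg Complex.re e3
      simp at ei er
      rcases ei with ei | ei
      swap
      · exact absurd ei hc
      rw [← ei] at er
      have : θ = 1 := by
        have : b * (1 - θ) = 0 := by linarith
        rcases mul_eq_zero.1 this with h | h
        · exact absurd h hb.ne'
        · linarith
      rw [e, this, hp]
      push_cast; ring
    · exfalso
      have a : z = x := by
        by_contra hne
        exact J.ne Tx (Tx.ts.uniq hz1 hne (Tβ.tt.seg hz2)).symm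
      have b : z = β := by
        by_contra hne
        exact J.ne Tx (Tβ.tt.uniq hz2 hne (Tx.ts.seg hz1))
      exact hxβ (a.symm.trans b)
    · exfalso
      have a : z = x := by
        by_contra hne
        exact J.ne Tx (Tx.tt.uniq hz1 hne (Tβ.ts.seg hz2))
      have b : z = β := by
        by_contra hne
        exact J.ne Tx (Tβ.ts.uniq hz2 hne (Tx.tt.seg hz1)).symm
      exact hxβ (a.symm.trans b)
    · right
      obtain ⟨θ, -, -, e⟩ := mem_seg.1 hz1
      obtain ⟨θ', -, -, e'⟩ := mem_seg.1 hz2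
      rw [hq] at e
      rw [hq, hβ] at e'
      have e3 := key (θ * (k - c * Complex.I)) (b + θ' * (k - b - c * Complex.I))
        (by linear_combination e' - e)
      have ei := congrArg Complex.im e3
      have er := congrArg Complex.re e3
      simp at ei er
      rcases ei with ei | ei
      swap
      · exact absurd ei hc
      rw [← ei] at er
      have : θ = 1 := by
        have : b * (1 - θ) = 0 := by linarith
        rcases mul_eq_zero.1 this with h | h
        · exact absurd h hb.ne'
        · linarith
      rw [e, this, hq]
      push_cast; ring
  have N3 := N1.union N2' hcx hcβ (by
    rw [hint]; exact isPreconnected_Icc.image _ J.cont.continuousOn)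
  refine kite_encloses (k := k) (hcx.union hcβ) hu0 hc h1 h1' ?_ ?_ ?_ ?_ N3
  · rw [← hp]; intro z hz; left; right; rw [J.LL_swap]; exact Or.inl hz
  · rw [← hq]; intro z hz; left; right; rw [J.LL_swap]; exact Or.inr hz
  · rw [← hp, ← hβ]; intro z hz; right; right; rw [J.LL_swap]; exact Or.inl hz
  · rw [← hq, ← hβ]; intro z hz; right; right; rw [J.LL_swap]; exact Or.inr hz

theorem exp_inj {θ A : ℝ} (h : Complex.exp (θ * Complex.I) = Complex.exp (A * Complex.I))
    (hlt : |θ - A| < 2 * Real.pi) : θ = A := by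
  obtain ⟨n, hn⟩ := Complex.exp_eq_exp_iff_exists_int.1 h
  have hn' : θ - A = n * (2 * Real.pi) := by
    have := congrArg Complex.im hn
    simp at this
    linarith
  rw [hn', abs_mul, abs_of_pos Real.two_pi_pos] at hlt
  have h1 : |(n : ℝ)| < 1 := by
    by_contra! hge
    nlinarith [Real.two_pi_pos]
  have h2 : n = 0 := by
    have : |n| < 1 := by exact_mod_cast h1
    exact Int.abs_lt_one_iff.1 this
  rw [h2] at hn'
  simp at hn'
  linarith

theorem sec_notMem {x : ℂ} {R r A θ : ℝ} (hr : 0 < r) (hR : 0 < R) (hne : θ ≠ A)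
    (hlt : |θ - A| < 2 * Real.pi) :
    x + r * Complex.exp (θ * Complex.I) ∉ segment ℝ x (x + R * Complex.exp (A * Complex.I)) := by
  intro h
  obtain ⟨l, hl, -, e⟩ := mem_seg.1 h
  have e' : (r : ℂ) * Complex.exp (θ * Complex.I) = (l * R : ℝ) * Complex.exp (A * Complex.I) := by
    push_cast
    linear_combination e
  have hn := congrArg norm e'
  rw [norm_mul, norm_mul, Complex.norm_exp_ofReal_mul_I, Complex.norm_exp_ofReal_mul_I,
    Complex.norm_real, Complex.norm_real, Real.norm_of_nonneg hr.le,
    Real.norm_of_nonneg (by positivity), mul_one, mul_one] at hn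
  rw [← hn] at e'
  have hr0 : (r : ℂ) ≠ 0 := by exact_mod_cast hr.ne'
  exact hne (exp_inj (mul_left_cancel₀ hr0 e') hlt)

/-- The sector at `x` enclosed by the arc from `s` to `t`. -/
theorem sector (J : JD γ E) {x : ℂ} {s t R : ℝ} (T : Tri γ E x s t) (hR : R = dist x (γ s)) :
    ∃ A B : ℝ, A ≠ B ∧ |B - A| < 2 * Real.pi ∧ γ s = x + R * Complex.exp (A * Complex.I) ∧
      γ t = x + R * Complex.exp (B * Complex.I) ∧
      ∀ r τ : ℝ, 0 < r → r < R → 0 < τ → τ < 1 →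
        x + r * Complex.exp ((A + τ * (B - A) : ℝ) * Complex.I) ∉ LL γ x s t ∧
        ¬ NE (CC γ x s t) (x + r * Complex.exp ((A + τ * (B - A) : ℝ) * Complex.I)) ∧
        NE (CC γ x t (s + 1)) (x + r * Complex.exp ((A + τ * (B - A) : ℝ) * Complex.I)) := by
  have hRt : R = dist x (γ t) := hR.trans (dist_eq T)
  have hRpos : 0 < R := hR ▸ J.Rpos T.mem s
  have polar : ∀ z : ℂ, z = x + dist x z * Complex.exp (Complex.arg (z - x) * Complex.I) := by
    intro z
    rw [dist_comm, dist_eq_norm, Complex.norm_mul_exp_arg_mul_I]; ring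
  have shift : ∀ A θ : ℝ, ∃ θ' ∈ Ico A (A + 2 * Real.pi),
      Complex.exp (θ' * Complex.I) = Complex.exp (θ * Complex.I) := by
    intro A θ
    refine ⟨toIcoMod Real.two_pi_pos A θ, toIcoMod_mem_Ico _ _ _, ?_⟩
    rw [Complex.exp_eq_exp_iff_exists_int]
    refine ⟨-toIcoDiv Real.two_pi_pos A θ, ?_⟩
    have h := self_sub_toIcoDiv_zsmul Real.two_pi_pos A θ
    rw [← h, zsmul_eq_mul]
    push_cast
    ring
  set A := Complex.arg (γ s - x) with hA
  have hp : γ s = x + R * Complex.exp (A * Complex.I) := by rw [hR]; exact polar _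
  obtain ⟨B, hB, hBe⟩ := shift A (Complex.arg (γ t - x))
  have hq : γ t = x + R * Complex.exp (B * Complex.I) := by rw [hRt, hBe]; exact polar _
  have hAB : A ≠ B := by
    intro h
    apply J.ne T
    rw [hp, hq, h]
  have hABlt : A < B := lt_of_le_of_ne hB.1 hAB
  -- general part
  have main : ∀ A B : ℝ, A ≠ B → |B - A| < 2 * Real.pi →
      γ s = x + R * Complex.exp (A * Complex.I) → γ t = x + R * Complex.exp (B * Complex.I) →
      (∃ r τ : ℝ, 0 < r ∧ r < R ∧ 0 < τ ∧ τ < 1 ∧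
        NE (CC γ x t (s + 1)) (x + r * Complex.exp ((A + τ * (B - A) : ℝ) * Complex.I))) →
      ∀ r τ : ℝ, 0 < r → r < R → 0 < τ → τ < 1 →
        x + r * Complex.exp ((A + τ * (B - A) : ℝ) * Complex.I) ∉ LL γ x s t ∧
        ¬ NE (CC γ x s t) (x + r * Complex.exp ((A + τ * (B - A) : ℝ) * Complex.I)) ∧
        NE (CC γ x t (s + 1)) (x + r * Complex.exp ((A + τ * (B - A) : ℝ) * Complex.I)) := by
    intro A B hAB hlt hp hq hex
    set S : Set ℂ := (fun v : ℝ × ℝ => x + v.1 * Complex.exp ((A + v.2 * (B - A) : ℝ) * Complex.I))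
      '' (Ioo 0 R ×ˢ Ioo 0 1) with hS
    have hSp : IsPreconnected S :=
      (isPreconnected_Ioo.prod isPreconnected_Ioo).image _ (by fun_prop)
    have hSL : ∀ z ∈ S, z ∉ LL γ x s t := by
      rintro _ ⟨⟨r, τ⟩, ⟨⟨hr1, hr2⟩, ⟨ht1, ht2⟩⟩, rfl⟩ hL
      dsimp only at *
      rcases hL with hL | hL
      · rw [hp] at hL
        refine sec_notMem hr1 hRpos ?_ ?_ hL
        · intro h
          have : τ * (B - A) = 0 := by linarith
          rcases mul_eq_zero.1 this with h | h
          · linarith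
          · exact hAB (by linarith)
        · rw [add_sub_cancel_left, abs_mul, abs_of_pos ht1]
          nlinarith [abs_nonneg (B - A)]
      · rw [hq] at hL
        refine sec_notMem hr1 hRpos ?_ ?_ hL
        · intro h
          have : (1 - τ) * (B - A) = 0 := by linarith
          rcases mul_eq_zero.1 this with h | h
          · linarith
          · exact hAB (by linarith)
        · rw [show A + τ * (B - A) - B = -((1 - τ) * (B - A)) by ring, abs_neg, abs_mul,
            abs_of_pos (by linarith)]
          nlinarith [abs_nonneg (B - A)]
    have hSE : S ⊆ E := by
      rintro _ ⟨⟨r, τ⟩, ⟨⟨hr1, hr2⟩, -⟩, rfl⟩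
      dsimp only at *
      apply J.ball_sub T.mem T.ts
      rw [mem_ball, dist_eq_norm, add_sub_cancel_left, norm_mul, Complex.norm_exp_ofReal_mul_I,
        Complex.norm_real, Real.norm_of_nonneg hr1.le, mul_one, ← hR]
      exact hr2
    have hSC : Disjoint S (CC γ x t (s + 1)) := by
      rw [Set.disjoint_left]
      rintro z hz (⟨τ, -, rfl⟩ | hL)
      · exact J.notMem τ (hSE hz)
      · rw [J.LL_swap] at hL
        exact hSL z hz hL
    intro r τ h1 h2 h3 h4
    have hyS : x + r * Complex.exp ((A + τ * (B - A) : ℝ) * Complex.I) ∈ S :=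
      ⟨(r, τ), ⟨⟨h1, h2⟩, ⟨h3, h4⟩⟩, rfl⟩
    obtain ⟨r', τ', g1, g2, g3, g4, hN⟩ := hex
    have hN' := NE.of_preconnected (J.isCompact_CC x t (s + 1)).isClosed hSp hSC
      ⟨(r', τ'), ⟨⟨g1, g2⟩, ⟨g3, g4⟩⟩, rfl⟩ hyS hN
    exact ⟨hSL _ hyS, fun h => J.not_both T (hSE hyS) h hN', hN'⟩
  obtain ⟨w, ⟨hwb, hwC⟩, hwN⟩ := J.exists_NE (J.swap T)
  rw [← hRt, mem_ball] at hwb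
  have hwL : w ∉ LL γ x s t := fun h => hwC (Or.inr (by rw [J.LL_swap]; exact h))
  have hwx : w ≠ x := by rintro rfl; exact hwL (Or.inl (left_mem_segment _ _ _))
  obtain ⟨θ, hθ, hθe⟩ := shift A (Complex.arg (w - x))
  set r := dist x w with hr
  have hrpos : 0 < r := dist_pos.2 hwx.symm
  have hrR : r < R := by rw [hr, dist_comm]; exact hwb
  have hw : w = x + r * Complex.exp (θ * Complex.I) := by rw [hθe]; exact polar w
  have onray : ∀ z : ℂ, z = x + R * Complex.exp (θ * Complex.I) → w ∈ segment ℝ x z := by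
    intro z hz
    refine mem_seg.2 ⟨r / R, by positivity, (div_le_one hRpos).2 hrR.le, ?_⟩
    rw [hz, hw]
    have : (R : ℂ) ≠ 0 := by exact_mod_cast hRpos.ne'
    push_cast
    field_simp
    ring
  have hθA : θ ≠ A := by
    rintro e
    exact hwL (Or.inl (onray _ (by rw [hp, e])))
  have hθB : θ ≠ B := by
    rintro e
    exact hwL (Or.inr (onray _ (by rw [hq, e])))
  have hθA' : A < θ := lt_of_le_of_ne hθ.1 (Ne.symm hθA)
  rcases lt_or_gt_of_ne hθB with hlt | hgt
  · have hlt2 : |B - A| < 2 * Real.pi := by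
      rw [abs_of_pos (by linarith)]; linarith [hB.2]
    refine ⟨A, B, hAB, hlt2, hp, hq, main A B hAB hlt2 hp hq
      ⟨r, (θ - A) / (B - A), hrpos, hrR, div_pos (by linarith) (by linarith),
        (div_lt_one (by linarith)).2 (by linarith), ?_⟩⟩
    rw [show A + (θ - A) / (B - A) * (B - A) = θ by
      have : B - A ≠ 0 := by linarith
      field_simp; ring, ← hw]
    exact hwN
  · have hlt2 : |B - (A + 2 * Real.pi)| < 2 * Real.pi := by
      rw [abs_of_neg (by linarith [hB.2])]; linarith [hB.2]
    have hp' : γ s = x + R * Complex.exp ((A + 2 * Real.pi : ℝ) * Complex.I) := by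
      rw [hp]
      congr 2
      push_cast
      rw [add_mul, Complex.exp_add, Complex.exp_two_pi_mul_I, mul_one]
    have hne : A + 2 * Real.pi ≠ B := by linarith [hB.2]
    have hneg : B - (A + 2 * Real.pi) < 0 := by linarith [hB.2]
    refine ⟨A + 2 * Real.pi, B, hne, hlt2, hp', hq, main _ B hne hlt2 hp' hq
      ⟨r, (θ - (A + 2 * Real.pi)) / (B - (A + 2 * Real.pi)), hrpos, hrR,
        div_pos_of_neg_of_neg (by linarith [hθ.2]) hneg,
        (div_lt_one_of_neg hneg).2 (by linarith), ?_⟩⟩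
    rw [div_mul_cancel₀ _ hneg.ne, add_sub_cancel, ← hw]
    exact hwN

end JD

namespace JD

variable {γ : ℝ → ℂ} {E : Set ℂ}

theorem exists_touch (J : JD γ E) (y : ℂ) : ∃ τ, Touch γ y τ := by
  have hcd : Continuous (fun τ => dist y (γ τ)) := continuous_const.dist J.cont
  obtain ⟨τ, -, hm⟩ := isCompact_Icc.exists_isMinOn (nonempty_Icc.2 (zero_le_one' ℝ))
    hcd.continuousOn
  refine ⟨τ, fun σ => ?_⟩
  obtain ⟨σ', hσ', e⟩ := J.reduce 0 σ
  rw [← e]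
  exact hm (show σ' ∈ Icc (0 : ℝ) 1 from ⟨hσ'.1, by linarith [hσ'.2]⟩)

theorem polar_dist (x : ℂ) (r R θ A : ℝ) :
    dist (x + r * Complex.exp (θ * Complex.I)) (x + R * Complex.exp (A * Complex.I)) ^ 2 =
      r ^ 2 + R ^ 2 - 2 * r * R * Real.cos (θ - A) := by
  rw [dist_eq_norm, add_sub_add_left_eq_sub, Complex.sq_norm, Complex.normSq_apply, Real.cos_sub]
  simp only [Complex.sub_re, Complex.sub_im, Complex.re_ofReal_mul, Complex.im_ofReal_mul,
    Complex.exp_ofReal_mul_I_re, Complex.exp_ofReal_mul_I_im]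
  linear_combination r ^ 2 * Real.sin_sq_add_cos_sq θ + R ^ 2 * Real.sin_sq_add_cos_sq A

theorem sin_half {d a : ℝ} (ha : |a| ≤ 1 / 2) (hd : |d| < 2 * Real.pi) (h0 : d ≠ 0)
    (h : Real.sin (a * d) = 0) : a = 0 := by
  have h1 : |a * d| < Real.pi := by
    rw [abs_mul]
    nlinarith [abs_nonneg a, abs_nonneg d]
  rw [abs_lt] at h1
  have := (Real.sin_eq_zero_iff_of_lt_of_lt h1.1 h1.2).1 h
  rcases mul_eq_zero.1 this with h | h
  · exact h
  · exact absurd h h0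

theorem step (J : JD γ E) {x : ℂ} {s t R A B : ℝ} (T : Tri γ E x s t) (hR : R = dist x (γ s))
    (hAB : A ≠ B) (hlt : |B - A| < 2 * Real.pi) (hp : γ s = x + R * Complex.exp (A * Complex.I))
    (hq : γ t = x + R * Complex.exp (B * Complex.I))
    (hsec : ∀ r τ : ℝ, 0 < r → r < R → 0 < τ → τ < 1 →
        x + r * Complex.exp ((A + τ * (B - A) : ℝ) * Complex.I) ∉ LL γ x s t ∧
        ¬ NE (CC γ x s t) (x + r * Complex.exp ((A + τ * (B - A) : ℝ) * Complex.I)))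
    (hmin : ∀ y σ τ, Tri γ E y σ τ → t - s ≤ τ - σ)
    (hext : ∀ r : ℝ, 0 < r → x + r * Complex.exp (((A + B) / 2 : ℝ) * Complex.I) ∈ E →
      ¬ (Touch γ (x + r * Complex.exp (((A + B) / 2 : ℝ) * Complex.I)) s ∧
        Touch γ (x + r * Complex.exp (((A + B) / 2 : ℝ) * Complex.I)) t)) : False := by
  have hRpos : 0 < R := hR ▸ J.Rpos T.mem s
  have hst := T.lt
  have hst' := T.lt'
  set m := (s + t) / 2 with hm
  have hsm : s < m := by rw [hm]; linarith
  have hmt : m < t := by rw [hm]; linarith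
  have hD : R < dist x (γ m) := by
    by_contra! hle
    have hT : Tri γ E x s m := ⟨T.mem, hsm, by linarith, T.ts, fun σ => by
      linarith [T.ts σ]⟩
    linarith [hmin x s m hT]
  obtain ⟨r, hr0, hr1⟩ : ∃ r : ℝ, 0 < r ∧ r < min R ((dist x (γ m) - R) / 2) :=
    exists_between (lt_min hRpos (by linarith))
  have hrR : r < R := hr1.trans_le (min_le_left _ _)
  have hrD : r < (dist x (γ m) - R) / 2 := hr1.trans_le (min_le_right _ _)
  set y : ℝ → ℂ := fun τ => x + r * Complex.exp ((A + τ * (B - A) : ℝ) * Complex.I) with hy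
  have hyc : Continuous y := by fun_prop
  have hyd : ∀ τ, dist (y τ) x = r := by
    intro τ
    rw [dist_eq_norm, hy, add_sub_cancel_left, norm_mul, Complex.norm_exp_ofReal_mul_I,
        Complex.norm_real, Real.norm_of_nonneg hr0.le, mul_one]
  have hyE : ∀ τ, y τ ∈ E := by
    intro τ
    apply J.ball_sub T.mem T.ts
    rw [mem_ball, hyd, ← hR]
    exact hrR
  have hRc : (R : ℂ) ≠ 0 := by exact_mod_cast hRpos.ne'
  have hy0 : Touch γ (y 0) s := by
    refine T.ts.seg (mem_seg.2 ⟨r / R, by positivity, (div_le_one hRpos).2 hrR.le, ?_⟩)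
    rw [hp, hy]
    simp only [zero_mul, add_zero]
    push_cast
    field_simp
    ring
  have hy1 : Touch γ (y 1) t := by
    refine T.tt.seg (mem_seg.2 ⟨r / R, by positivity, (div_le_one hRpos).2 hrR.le, ?_⟩)
    rw [hq, hy]
    simp only [one_mul, add_sub_cancel]
    push_cast
    field_simp
    ring
  have hnear : ∀ τ ∈ Icc (0 : ℝ) 1, ∃ σ ∈ Icc s t, Touch γ (y τ) σ := by
    intro τ hτ
    by_cases h0 : τ = 0
    · exact ⟨s, ⟨le_rfl, hst.le⟩, h0 ▸ hy0⟩
    by_cases h1 : τ = 1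
    · exact ⟨t, ⟨hst.le, le_rfl⟩, h1 ▸ hy1⟩
    obtain ⟨a, b⟩ := hsec r τ hr0 hrR (lt_of_le_of_ne hτ.1 (Ne.symm h0)) (lt_of_le_of_ne hτ.2 h1)
    obtain ⟨τ', hτ'⟩ := J.exists_touch (y τ)
    obtain ⟨σ, hσ, e⟩ := J.nearest_mem T (hyE τ) a b hτ'
    exact ⟨σ, hσ, fun u => by rw [e]; exact hτ' u⟩
  set K1 := γ '' Icc s m with hK1
  set K2 := γ '' Icc m t with hK2
  have c1 : IsCompact K1 := J.isCompact_arc s m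
  have c2 : IsCompact K2 := J.isCompact_arc m t
  have n1 : K1.Nonempty := (nonempty_Icc.2 hsm.le).image _
  have n2 : K2.Nonempty := (nonempty_Icc.2 hmt.le).image _
  set f : ℝ → ℝ := fun τ => infDist (y τ) K1 - infDist (y τ) K2 with hf
  have hfc : Continuous f :=
    ((continuous_infDist_pt K1).comp hyc).sub ((continuous_infDist_pt K2).comp hyc)
  have hf0 : f 0 ≤ 0 := by
    have a1 : infDist (y 0) K1 ≤ dist (y 0) (γ s) :=
      infDist_le_dist_of_mem ⟨s, ⟨le_rfl, hsm.le⟩, rfl⟩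
    have a2 : dist (y 0) (γ s) ≤ infDist (y 0) K2 := by
      rw [le_infDist n2]
      rintro _ ⟨σ, -, rfl⟩
      exact hy0 σ
    simp only [hf]; linarith
  have hf1 : 0 ≤ f 1 := by
    have a1 : infDist (y 1) K2 ≤ dist (y 1) (γ t) :=
      infDist_le_dist_of_mem ⟨t, ⟨hmt.le, le_rfl⟩, rfl⟩
    have a2 : dist (y 1) (γ t) ≤ infDist (y 1) K1 := by
      rw [le_infDist n1]
      rintro _ ⟨σ, -, rfl⟩
      exact hy1 σ
    simp only [hf]; linarith
  obtain ⟨τ, hτ, hτ0⟩ := intermediate_value_Icc (zero_le_one' ℝ) hfc.continuousOn ⟨hf0, hf1⟩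
  obtain ⟨_, ⟨σ1, hσ1, rfl⟩, e1⟩ := c1.exists_infDist_eq_dist n1 (y τ)
  obtain ⟨_, ⟨σ2, hσ2, rfl⟩, e2⟩ := c2.exists_infDist_eq_dist n2 (y τ)
  have e12 : dist (y τ) (γ σ1) = dist (y τ) (γ σ2) := by
    simp only [hf] at hτ0; linarith
  obtain ⟨σ, hσ, hσT⟩ := hnear τ hτ
  have hle : dist (y τ) (γ σ1) ≤ dist (y τ) (γ σ) := by
    rcases le_total σ m with h | h
    · rw [← e1]; exact infDist_le_dist_of_mem ⟨σ, ⟨hσ.1, h⟩, rfl⟩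
    · rw [e12, ← e2]; exact infDist_le_dist_of_mem ⟨σ, ⟨h, hσ.2⟩, rfl⟩
  have T1 : Touch γ (y τ) σ1 := fun u => hle.trans (hσT u)
  have T2 : Touch γ (y τ) σ2 := fun u => e12 ▸ T1 u
  rcases lt_or_ge σ1 σ2 with h12 | h12
  · have hTri : Tri γ E (y τ) σ1 σ2 :=
      ⟨hyE τ, h12, by linarith [hσ1.1, hσ2.2], T1, T2⟩
    have hge := hmin _ _ _ hTri
    have s1 : σ1 = s := by linarith [hσ1.1, hσ2.2]
    have s2 : σ2 = t := by linarith [hσ1.1, hσ2.2]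
    rw [s1, s2] at e12
    rw [s1] at T1
    rw [s2] at T2
    have e3 := congrArg (fun v => v ^ 2) e12
    simp only [hp, hq, hy, polar_dist] at e3
    have e4 : Real.cos (A + τ * (B - A) - A) = Real.cos (A + τ * (B - A) - B) := by
      have : 2 * r * R ≠ 0 := by positivity
      exact mul_left_cancel₀ this (by linarith)
    have e5 : Real.sin (1 / 2 * (B - A)) = 0 ∨ Real.sin ((τ - 1 / 2) * (B - A)) = 0 := by
      have h := Real.cos_sub_cos (A + τ * (B - A) - A) (A + τ * (B - A) - B)
      rw [e4, sub_self, show (A + τ * (B - A) - A + (A + τ * (B - A) - B)) / 2 =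
        (τ - 1 / 2) * (B - A) by ring, show (A + τ * (B - A) - A - (A + τ * (B - A) - B)) / 2 =
        1 / 2 * (B - A) by ring] at h
      by_contra! hcon
      have := mul_ne_zero hcon.2 hcon.1
      exact this (by linarith)
    have hd : B - A ≠ 0 := sub_ne_zero.2 hAB.symm
    rcases e5 with e5 | e5
    · have := sin_half (by rw [abs_of_pos (by norm_num)]) hlt hd e5
      norm_num at this
    · have h := sin_half (by rw [abs_le]; constructor <;> linarith [hτ.1, hτ.2]) hlt hd e5
      have hyτ : y τ = x + r * Complex.exp (((A + B) / 2 : ℝ) * Complex.I) := by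
        simp only [hy]
        rw [show A + τ * (B - A) = (A + B) / 2 by
          rw [show τ = 1 / 2 by linarith]; ring]
      rw [hyτ] at T1 T2
      exact hext r hr0 (hyτ ▸ hyE τ) ⟨T1, T2⟩
  · have sm : σ1 = m := by linarith [hσ1.2, hσ2.1]
    rw [sm] at T1
    have a1 := T1 s
    have a2 := dist_triangle x (y τ) (γ m)
    have a3 := dist_triangle (y τ) x (γ s)
    rw [hyd, ← hR] at a3
    rw [dist_comm x (y τ), hyd] at a2
    linarith

end JD

namespace JD

variable {γ : ℝ → ℂ} {E : Set ℂ}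

theorem frame (J : JD γ E) {x : ℂ} {s t : ℝ} (T : Tri γ E x s t)
    (hmin : ∀ y σ τ, Tri γ E y σ τ → t - s ≤ τ - σ) :
    ∃ (u : ℂ) (k c r₀ : ℝ), ‖u‖ = 1 ∧ c ≠ 0 ∧ 0 < r₀ ∧
      γ s = x + u * (k + c * Complex.I) ∧ γ t = x + u * (k - c * Complex.I) ∧
      (∀ r : ℝ, 0 < r → r < r₀ → NE (CC γ x t (s + 1)) (x + u * r)) ∧
      ((∀ r : ℝ, 0 < r → x + u * r ∈ E →
        ¬ (Touch γ (x + u * r) s ∧ Touch γ (x + u * r) t)) → False) := by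
  set R := dist x (γ s) with hR
  have hRpos : 0 < R := J.Rpos T.mem s
  obtain ⟨A, B, hAB, hlt, hp, hq, hsec⟩ := J.sector T hR
  set δ := (A - B) / 2 with hδ
  set u := Complex.exp (((A + B) / 2 : ℝ) * Complex.I) with hu
  have hδs : Real.sin δ ≠ 0 := by
    intro h
    rw [hδ, div_eq_mul_inv, mul_comm] at h
    have := sin_half (by norm_num [abs_of_pos]) (by rwa [abs_sub_comm]) (sub_ne_zero.2 hAB) h
    norm_num at this
  have eA : Complex.exp (A * Complex.I) = u * (Real.cos δ + Real.sin δ * Complex.I) := by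
    rw [hu, Complex.ofReal_cos, Complex.ofReal_sin, ← Complex.exp_mul_I, ← Complex.exp_add, hδ]
    congr 1
    push_cast
    ring
  have eB : Complex.exp (B * Complex.I) = u * (Real.cos δ - Real.sin δ * Complex.I) := by
    have h := Complex.exp_mul_I (-(δ : ℂ))
    rw [Complex.cos_neg, Complex.sin_neg, neg_mul (Complex.sin _) Complex.I, ← sub_eq_add_neg] at h
    rw [hu, Complex.ofReal_cos, Complex.ofReal_sin, ← h, ← Complex.exp_add, hδ]
    congr 1
    push_cast
    ring
  refine ⟨u, R * Real.cos δ, R * Real.sin δ, R, Complex.norm_exp_ofReal_mul_I _,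
    mul_ne_zero hRpos.ne' hδs, hRpos, ?_, ?_, ?_, ?_⟩
  · rw [hp, eA]; push_cast; ring
  · rw [hq, eB]; push_cast; ring
  · intro r h0 h1
    have h := (hsec r (1 / 2) h0 h1 (by norm_num) (by norm_num)).2.2
    rwa [show A + 1 / 2 * (B - A) = (A + B) / 2 by ring, ← hu, mul_comm] at h
  · intro hext
    refine J.step T hR hAB hlt hp hq (fun r τ a b c d => ?_) hmin (fun r hr => ?_)
    · obtain ⟨h1, h2, -⟩ := hsec r τ a b c d
      exact ⟨h1, h2⟩
    · rw [← hu, mul_comm]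
      exact hext r hr

theorem closed_touch (τ : ℝ) : IsClosed {y : ℂ | Touch γ y τ} := by
  have : {y : ℂ | Touch γ y τ} = ⋂ σ, {y | dist y (γ τ) ≤ dist y (γ σ)} := by
    ext y; simp [Touch]
  rw [this]
  exact isClosed_iInter fun σ => isClosed_le (by fun_prop) (by fun_prop)

theorem mem_of_touch (J : JD γ E) {y : ℂ} {s t : ℝ} (hy : y ∈ closure E) (hs : Touch γ y s)
    (ht : Touch γ y t) (hne : γ s ≠ γ t) : y ∈ E := by
  by_contra hyE
  have hf : y ∈ frontier E := by rw [J.opn.frontier_eq]; exact ⟨hy, hyE⟩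
  rw [J.fr] at hf
  obtain ⟨σ, rfl⟩ := hf
  have h1 := hs σ
  have h2 := ht σ
  rw [dist_self] at h1 h2
  have e1 := dist_le_zero.1 h1
  have e2 := dist_le_zero.1 h2
  exact hne (e1.symm.trans e2)

theorem no_min (J : JD γ E) {x : ℂ} {s t : ℝ} (T : Tri γ E x s t)
    (hmin : ∀ y σ τ, Tri γ E y σ τ → t - s ≤ τ - σ) : False := by
  obtain ⟨u, k, c, r₀, hu, hc, hr₀, hp, hq, hN, hstep⟩ := J.frame T hmin
  have hu0 : u ≠ 0 := by
    rintro rfl; simp at hu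
  set X : Set ℂ := closure E ∩ ({y | Touch γ y s} ∩ {y | Touch γ y t}) with hX
  have hXc : IsCompact X :=
    J.bdd.isCompact_closure.inter_right ((closed_touch s).inter (closed_touch t))
  have hxX : x ∈ X := ⟨subset_closure T.mem, T.ts, T.tt⟩
  set g : ℂ → ℝ := fun y => (y / u).re with hg
  have hgc : Continuous g := by
    simp only [hg]; exact Complex.continuous_re.comp (continuous_id.div_const u)
  obtain ⟨β, hβX, hβm⟩ := hXc.exists_isMaxOn ⟨x, hxX⟩ hgc.continuousOn
  have hβE : β ∈ E := J.mem_of_touch hβX.1 hβX.2.1 hβX.2.2 (J.ne T)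
  have Tβ : Tri γ E β s t := ⟨hβE, T.lt, T.lt', hβX.2.1, hβX.2.2⟩
  have hgadd : ∀ (z : ℂ) (r : ℝ), g (z + u * r) = g z + r := by
    intro z r
    simp only [hg]
    rw [add_div, mul_div_cancel_left₀ _ hu0]
    simp
  have hext : ∀ r : ℝ, 0 < r → β + u * r ∈ E →
      ¬ (Touch γ (β + u * r) s ∧ Touch γ (β + u * r) t) := by
    rintro r hr hE ⟨h1, h2⟩
    have := hβm (show β + u * r ∈ X from ⟨subset_closure hE, h1, h2⟩)
    simp only [mem_ofPred_eq, hgadd] at this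
    linarith
  obtain ⟨b, hb⟩ : ∃ b : ℝ, β = x + u * b := by
    have hd := dist_eq Tβ
    set z := (β - x) / u with hz
    have hβz : β = x + u * z := by rw [hz]; field_simp; ring
    rw [hβz, hp, hq, dist_eq_norm, dist_eq_norm,
      show x + u * z - (x + u * (k + c * Complex.I)) = u * (z - k - c * Complex.I) by ring,
      show x + u * z - (x + u * (k - c * Complex.I)) = u * (z - k + c * Complex.I) by ring,
      norm_mul, norm_mul, hu, one_mul, one_mul] at hd
    have h2 := congrArg (fun v => v ^ 2) hd
    simp only [Complex.sq_norm, Complex.normSq_apply] at h2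
    simp at h2
    have h3 : c * z.im = 0 := by nlinarith
    have h4 : z.im = 0 := (mul_eq_zero.1 h3).resolve_left hc
    refine ⟨z.re, ?_⟩
    rw [hβz]
    congr 2
    apply Complex.ext <;> simp [h4]
  have hb0 : 0 ≤ b := by
    have h := hβm hxX
    simp only [mem_ofPred_eq] at h
    rw [hb, hgadd] at h
    linarith
  rcases hb0.eq_or_lt with hb0 | hb0
  · have : β = x := by rw [hb, ← hb0]; simp
    rw [this] at hext
    exact hstep hext
  obtain ⟨u', k', c', r₀', hu', hc', hr₀', hp', hq', hN', hstep'⟩ := J.frame Tβ hmin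
  have hcu : (c : ℂ) * u = c' * u' := by
    have h1 : u * (k + c * Complex.I) - u * (k - c * Complex.I) =
        u' * (k' + c' * Complex.I) - u' * (k' - c' * Complex.I) := by
      linear_combination -hp + hq + hp' - hq'
    have h2 : (2 * Complex.I) * (c * u) = (2 * Complex.I) * (c' * u') := by
      linear_combination h1
    exact mul_left_cancel₀ (by simp) h2
  have habs : |c| = |c'| := by
    have h := congrArg norm hcu
    rwa [norm_mul, norm_mul, hu, hu', mul_one, mul_one, Complex.norm_real, Complex.norm_real] at h
  have hcc : (c : ℂ) ≠ 0 := by exact_mod_cast hc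
  have huu : u' = u ∨ u' = -u := by
    rcases abs_eq_abs.1 habs with h | h
    · left
      rw [← h] at hcu
      exact (mul_left_cancel₀ hcc hcu).symm
    · right
      have h' : c' = -c := by linarith
      rw [h'] at hcu
      push_cast at hcu
      apply mul_left_cancel₀ hcc
      linear_combination hcu
  rcases huu with h | h
  · rw [h] at hstep'
    exact hstep' hext
  · obtain ⟨r₁, h1, h1'⟩ := exists_between (lt_min hr₀ hb0)
    obtain ⟨r', h2, h2'⟩ := exists_between (lt_min hr₀' hb0)
    rw [lt_min_iff] at h1' h2'
    refine J.kite (r₁ := r₁) (r₂ := b - r') T Tβ hu hc hb0 hp hq hb h1 h1'.2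
      (by linarith) (by linarith) (hN r₁ h1 h1'.1) ?_
    have h3 := hN' r' h2 h2'.1
    rwa [h, show β + -u * r' = x + u * ((b - r' : ℝ) : ℂ) by rw [hb]; push_cast; ring] at h3

end JD

namespace JD

variable {γ : ℝ → ℂ} {E : Set ℂ}

theorem touch_infDist {y : ℂ} {σ : ℝ} (h : Touch γ y σ) :
    infDist y (range γ) = dist y (γ σ) := by
  apply le_antisymm
  · exact infDist_le_dist_of_mem ⟨σ, rfl⟩
  · rw [le_infDist (range_nonempty γ)]
    rintro _ ⟨τ, rfl⟩
    exact h τ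

theorem two_touch (J : JD γ E) (hne : E.Nonempty) :
    ∃ x s t, Tri γ E x s t ∧ ∀ y ∈ E, ∀ σ, Touch γ y σ → dist y (γ σ) ≤ dist x (γ s) := by
  obtain ⟨x, hx, hmax⟩ := J.bdd.isCompact_closure.exists_isMaxOn hne.closure
    (continuous_infDist_pt (range γ)).continuousOn
  have hmax' : ∀ y ∈ closure E, infDist y (range γ) ≤ infDist x (range γ) := fun y hy => hmax hy
  have hxE : x ∈ E := by
    by_contra hxE
    have hf : x ∈ frontier E := by rw [J.opn.frontier_eq]; exact ⟨hx, hxE⟩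
    rw [J.fr] at hf
    obtain ⟨y, hy⟩ := hne
    obtain ⟨σ, hσ⟩ := J.exists_touch y
    have h1 := hmax' y (subset_closure hy)
    rw [infDist_zero_of_mem hf, touch_infDist hσ] at h1
    linarith [J.Rpos hy σ]
  obtain ⟨s, hs⟩ := J.exists_touch x
  rw [touch_infDist hs] at hmax'
  have hm2 : ∀ y ∈ E, ∀ σ, Touch γ y σ → dist y (γ σ) ≤ dist x (γ s) := by
    intro y hy σ hσ
    rw [← touch_infDist hσ]
    exact hmax' y (subset_closure hy)
  suffices h : ∃ τ, Touch γ x τ ∧ γ τ ≠ γ s by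
    obtain ⟨τ, hτ, hτne⟩ := h
    obtain ⟨t, ht, e⟩ := J.reduce s τ
    refine ⟨x, s, t, ⟨hxE, lt_of_le_of_ne ht.1 ?_, ht.2, hs, fun σ => by rw [e]; exact hτ σ⟩, hm2⟩
    rintro rfl
    exact hτne e.symm
  by_contra! huniq
  set R := dist x (γ s) with hR
  have hRpos : 0 < R := J.Rpos hxE s
  have hRn : ‖x - γ s‖ = R := by rw [hR, dist_eq_norm]
  set φ : ℝ → ℝ := fun τ => inner ℝ (x - γ τ) (x - γ s) with hφ
  have hγ := J.cont
  have hφc : Continuous φ := by fun_prop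
  have hdc : Continuous (fun τ => dist x (γ τ)) := by fun_prop
  set K : Set ℝ := Icc 0 1 ∩ {τ | φ τ ≤ 0} with hK
  have hKc : IsCompact K := isCompact_Icc.inter_right (isClosed_le hφc continuous_const)
  have hKR : ∀ τ ∈ K, R < dist x (γ τ) := by
    intro τ hτ
    by_contra! hle
    have hT : Touch γ x τ := fun σ => hle.trans (hs σ)
    have h1 : φ τ ≤ 0 := hτ.2
    simp only [hφ, huniq τ hT, real_inner_self_eq_norm_sq, hRn] at h1
    nlinarith
  obtain ⟨m, hmR, hm⟩ : ∃ m, R < m ∧ ∀ τ ∈ K, m ≤ dist x (γ τ) := by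
    rcases K.eq_empty_or_nonempty with h | h
    · exact ⟨R + 1, by linarith, by simp [h]⟩
    · obtain ⟨τ, hτ, hmin⟩ := hKc.exists_isMinOn h hdc.continuousOn
      exact ⟨_, hKR τ hτ, fun σ hσ => hmin hσ⟩
  obtain ⟨r, hr0, hr⟩ := exists_between (lt_min hRpos (sub_pos.2 hmR))
  rw [lt_min_iff] at hr
  set ε := r / R with hε
  have hε0 : 0 < ε := by positivity
  have hεR : ε * R = r := by rw [hε]; field_simp
  set y : ℂ := x + ε • (x - γ s) with hy
  have hyd : dist x y = r := by
    rw [dist_comm, dist_eq_norm, hy, add_sub_cancel_left, norm_smul, hRn,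
      Real.norm_of_nonneg hε0.le, hεR]
  have hyE : y ∈ E := J.ball_sub hxE hs (by rw [mem_ball, dist_comm, hyd]; exact hr.1)
  obtain ⟨σ, hσ⟩ := J.exists_touch y
  have hle := hm2 y hyE σ hσ
  obtain ⟨τ, hτ, e⟩ := J.reduce 0 σ
  rw [← e] at hle
  rcases le_or_gt (φ τ) 0 with h | h
  · have h1 := hm τ ⟨⟨hτ.1, by linarith [hτ.2]⟩, h⟩
    have h2 := dist_triangle x y (γ τ)
    linarith [hr.2]
  · have h1 : R ≤ ‖x - γ τ‖ := by rw [← dist_eq_norm]; exact hs τ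
    have h2 : ‖y - γ τ‖ ≤ R := by rw [← dist_eq_norm]; exact hle
    have h3 := norm_add_sq_real (x - γ τ) (ε • (x - γ s))
    rw [show x - γ τ + ε • (x - γ s) = y - γ τ by rw [hy]; abel, inner_smul_right] at h3
    have h4 : 0 < ε * inner ℝ (x - γ τ) (x - γ s) := mul_pos hε0 h
    nlinarith [norm_nonneg (y - γ τ), sq_nonneg ‖ε • (x - γ s)‖]

theorem shift_int (J : JD γ E) (τ : ℝ) (n : ℤ) : γ (τ - n) = γ τ :=
  (J.inj _ _).2 ⟨-n, by push_cast; ring⟩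

theorem Tri_shift (J : JD γ E) {x : ℂ} {s t : ℝ} (T : Tri γ E x s t) (n : ℤ) :
    Tri γ E x (s - n) (t - n) where
  mem := T.mem
  lt := by linarith [T.lt]
  lt' := by linarith [T.lt']
  ts := fun σ => by rw [J.shift_int]; exact T.ts σ
  tt := fun σ => by rw [J.shift_int]; exact T.tt σ

theorem closed_touch2 (hγ : Continuous γ) {f : ℂ × ℝ × ℝ → ℝ} (hf : Continuous f) :
    IsClosed {v : ℂ × ℝ × ℝ | Touch γ v.1 (f v)} := by
  have : {v : ℂ × ℝ × ℝ | Touch γ v.1 (f v)} =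
      ⋂ σ, {v | dist v.1 (γ (f v)) ≤ dist v.1 (γ σ)} := by
    ext y; simp [Touch]
  rw [this]
  exact isClosed_iInter fun σ => isClosed_le (by fun_prop) (by fun_prop)

theorem main (J : JD γ E) (hne : E.Nonempty) {ρ₀ : ℝ}
    (hcurv : ∀ z ∈ frontier E, ∀ (y : ℂ) (ρ : ℝ), 0 < ρ → z ∈ sphere y ρ →
      (∃ ε > 0, E ∩ ball z ε ⊆ closedBall y ρ) → ρ₀ ≤ ρ) :
    ∃ x ∈ E, ∀ τ, ρ₀ ≤ dist x (γ τ) := by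
  by_contra! hcon
  obtain ⟨x, s, t, T, hmax⟩ := J.two_touch hne
  set d := dist x (γ s) with hd
  have hdρ : d < ρ₀ := by
    obtain ⟨τ, hτ⟩ := hcon x T.mem
    exact (T.ts τ).trans_lt hτ
  have huc := (isCompact_Icc (a := (0 : ℝ)) (b := 2)).uniformContinuousOn_of_continuous
    J.cont.continuousOn
  rw [Metric.uniformContinuousOn_iff] at huc
  obtain ⟨l, hl, hlu⟩ := huc (ρ₀ - d) (by linarith)
  have hshort : ∀ y σ τ, Tri γ E y σ τ → 0 ≤ σ → σ ≤ 1 → l ≤ τ - σ := by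
    intro y σ τ T' h0 h1
    by_contra! hlt
    refine J.short_arc T' hcurv (fun a ha => ?_)
    have h2 := T'.lt'
    have h3 := hlu σ ⟨h0, by linarith⟩ a ⟨by linarith [ha.1], by linarith [ha.2]⟩ (by
      rw [Real.dist_eq, abs_lt]; constructor <;> linarith [ha.1, ha.2])
    have h4 := dist_triangle y (γ σ) (γ a)
    have h5 := hmax y T'.mem σ T'.ts
    linarith
  set P : Set (ℂ × ℝ × ℝ) := (closure E ×ˢ (Icc 0 1 ×ˢ Icc 0 2)) ∩
    ({v | v.2.1 + l ≤ v.2.2} ∩ ({v | v.2.2 ≤ v.2.1 + (t - s)} ∩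
      ({v | Touch γ v.1 v.2.1} ∩ {v | Touch γ v.1 v.2.2}))) with hP
  have hPc : IsCompact P := by
    refine (J.bdd.isCompact_closure.prod (isCompact_Icc.prod isCompact_Icc)).inter_right ?_
    refine (isClosed_le (by fun_prop) (by fun_prop)).inter
      ((isClosed_le (by fun_prop) (by fun_prop)).inter ?_)
    exact (closed_touch2 J.cont (by fun_prop)).inter (closed_touch2 J.cont (by fun_prop))
  have hmem : ∀ y σ τ, Tri γ E y σ τ → τ - σ ≤ t - s → ∃ v ∈ P, v.2.2 - v.2.1 = τ - σ := by
    intro y σ τ T' hle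
    have T2 := J.Tri_shift T' ⌊σ⌋
    have a1 := Int.floor_le σ
    have a2 := Int.lt_floor_add_one σ
    have a3 := hshort _ _ _ T2 (by linarith) (by linarith)
    have a4 := T2.lt
    have a5 := T2.lt'
    refine ⟨(y, σ - ⌊σ⌋, τ - ⌊σ⌋), ⟨⟨subset_closure T'.mem, ⟨?_, ?_⟩, ?_, ?_⟩, ?_, ?_, T2.ts, T2.tt⟩,
      ?_⟩
    all_goals simp only [mem_ofPred_eq]
    all_goals linarith
  obtain ⟨v₀, hv₀, -⟩ := hmem x s t T le_rfl
  obtain ⟨⟨z, a, b⟩, hv, hmin⟩ := hPc.exists_isMinOn ⟨v₀, hv₀⟩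
    (f := fun v : ℂ × ℝ × ℝ => v.2.2 - v.2.1) (by fun_prop)
  obtain ⟨⟨hz, -, -⟩, h1, h2, h3, h4⟩ := hv
  simp only [mem_ofPred_eq] at h1 h2 h3 h4
  have hT := T.lt'
  have hab : γ a ≠ γ b := by
    intro h
    have := J.inj' h (by linarith) (by linarith)
    linarith
  refine J.no_min (x := z) (s := a) (t := b)
    ⟨J.mem_of_touch hz h3 h4 hab, by linarith, by linarith, h3, h4⟩ ?_
  intro y σ τ T'
  rcases le_or_gt (τ - σ) (t - s) with hle | hgt
  · obtain ⟨v, hv, e⟩ := hmem y σ τ T' hle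
    rw [← e]
    exact hmin hv
  · linarith

end JD

theorem contains_ball_of_viscosity_curvature_bound (E : Set (EuclideanSpace ℝ (Fin 2)))
    (h : ℝ) (hpos : 0 < h) (hE : IsJordanDomain E) (hcurv : ViscCurvLE E h) :
    ∃ x ∈ E, 1 / h ≤ Metric.infDist x (frontier E) := by
  obtain ⟨Γ, ⟨H⟩, hopen, hbdd, hconn, hfr, -⟩ := hE
  set φ : EuclideanSpace ℝ (Fin 2) ≃ₗᵢ[ℝ] ℂ := Complex.orthonormalBasisOneI.repr.symm with hφ
  have hmem : ∀ s : ℝ, φ.symm (Complex.exp ((2 * Real.pi * s : ℝ) * Complex.I)) ∈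
      Metric.sphere (0 : EuclideanSpace ℝ (Fin 2)) 1 := by
    intro s
    rw [mem_sphere_zero_iff_norm, LinearIsometryEquiv.norm_map, Complex.norm_exp_ofReal_mul_I]
  set γ : ℝ → ℂ := fun s =>
    φ (H ⟨φ.symm (Complex.exp ((2 * Real.pi * s : ℝ) * Complex.I)), hmem s⟩ : Γ).1 with hγ
  have hfr' : frontier (φ '' E) = φ '' frontier E := (φ.toHomeomorph.image_frontier E).symm
  have hrange : range γ = φ '' Γ := by
    ext z
    constructor
    · rintro ⟨s, rfl⟩
      exact ⟨_, Subtype.coe_prop _, rfl⟩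
    · rintro ⟨w, hw, rfl⟩
      set v := H.symm ⟨w, hw⟩ with hv
      have hn : ‖φ v.1‖ = 1 := by
        rw [LinearIsometryEquiv.norm_map]; exact mem_sphere_zero_iff_norm.1 v.2
      have he := Complex.norm_mul_exp_arg_mul_I (φ v.1)
      rw [hn, Complex.ofReal_one, one_mul] at he
      refine ⟨Complex.arg (φ v.1) / (2 * Real.pi), ?_⟩
      simp only [hγ]
      congr 1
      have e2 : (⟨φ.symm (Complex.exp ((2 * Real.pi * (Complex.arg (φ v.1) / (2 * Real.pi)) : ℝ) *
          Complex.I)), hmem _⟩ : Metric.sphere (0 : EuclideanSpace ℝ (Fin 2)) 1) = v := by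
        apply Subtype.ext
        simp only
        rw [mul_div_cancel₀ _ Real.two_pi_pos.ne', he, LinearIsometryEquiv.symm_apply_apply]
      rw [e2, hv, Homeomorph.apply_symm_apply]
  have J : JD γ (φ '' E) := by
    refine ⟨?_, ?_, ?_, ?_, ?_⟩
    · refine φ.continuous.comp (continuous_subtype_val.comp (H.continuous.comp ?_))
      refine Continuous.subtype_mk (φ.symm.continuous.comp ?_) _
      fun_prop
    · intro s t
      have e1 : γ s = γ t ↔ Complex.exp ((2 * Real.pi * s : ℝ) * Complex.I) =
          Complex.exp ((2 * Real.pi * t : ℝ) * Complex.I) := by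
        simp only [hγ]
        rw [φ.injective.eq_iff, Subtype.coe_inj, H.injective.eq_iff, Subtype.mk.injEq,
          φ.symm.injective.eq_iff]
      rw [e1, Complex.exp_eq_exp_iff_exists_int]
      constructor
      · rintro ⟨n, hn⟩
        refine ⟨n, ?_⟩
        have h2 := congrArg Complex.im hn
        simp at h2
        have h3 : (2 * Real.pi) * s = (2 * Real.pi) * (t + n) := by linarith
        exact mul_left_cancel₀ Real.two_pi_pos.ne' h3
      · rintro ⟨n, rfl⟩
        refine ⟨n, ?_⟩
        push_cast
        ring
    · exact φ.toHomeomorph.isOpenMap _ hopen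
    · exact φ.lipschitz.isBounded_image hbdd
    · rw [hfr', hfr, hrange]
  obtain ⟨x, hx, hxd⟩ := J.main (ρ₀ := 1 / h) (hconn.nonempty.image _) (by
    intro z hz y ρ hρ hzs hε
    rw [hfr'] at hz
    obtain ⟨w, hw, rfl⟩ := hz
    obtain ⟨ε, hε0, hεs⟩ := hε
    refine hcurv w hw (φ.symm y) ρ hρ ?_ ⟨ε, hε0, ?_⟩
    · rw [mem_sphere, ← φ.dist_map, LinearIsometryEquiv.apply_symm_apply]
      exact hzs
    · rintro v ⟨hv1, hv2⟩
      have := hεs ⟨⟨v, hv1, rfl⟩, by rw [mem_ball, φ.dist_map]; exact hv2⟩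
      rw [mem_closedBall] at this
      rw [mem_closedBall, ← φ.dist_map, LinearIsometryEquiv.apply_symm_apply]
      exact this)
  obtain ⟨w, hw, rfl⟩ := hx
  refine ⟨w, hw, ?_⟩
  have hne : (frontier E).Nonempty := by
    have : (range γ).Nonempty := range_nonempty γ
    rw [hrange, ← hfr] at this
    exact this.of_image
  rw [le_infDist hne]
  intro v hv
  rw [hfr] at hv
  obtain ⟨τ, hτ⟩ : φ v ∈ range γ := by rw [hrange]; exact ⟨v, hv, rfl⟩
  have := hxd τ
  rwa [hτ, φ.dist_map] at this
end

section
/- If a set of locally finite perimeter E ⊂ ℝ² (normalized so that the closure of its reduced boundary equals its topological boundary) has variational curvature bounded from above by a constant h > 0, then E has curvature bounded from above by h in the viscosity sense at every point x ∈ ∂E. -/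
open MeasureTheory Metric Set ENNReal

/-- Divergence of a vector field on `ℝ²`. -/
noncomputable def vdiv (φ : EuclideanSpace ℝ (Fin 2) → EuclideanSpace ℝ (Fin 2))
    (x : EuclideanSpace ℝ (Fin 2)) : ℝ :=
  ∑ i : Fin 2, fderiv ℝ φ x (EuclideanSpace.single i 1) i

/-- Relative (distributional) perimeter of `E` in the open set `A`. -/
noncomputable def perimeterIn (E A : Set (EuclideanSpace ℝ (Fin 2))) : ℝ≥0∞ :=
  ⨆ (φ : EuclideanSpace ℝ (Fin 2) → EuclideanSpace ℝ (Fin 2)) (_ : ContDiff ℝ 1 φ)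
    (_ : HasCompactSupport φ) (_ : tsupport φ ⊆ A) (_ : ∀ x, ‖φ x‖ ≤ 1),
    ENNReal.ofReal (∫ x in E, vdiv φ x)

/-- `E` has locally finite perimeter. -/
def HasLocFinitePerimeter (E : Set (EuclideanSpace ℝ (Fin 2))) : Prop :=
  ∀ (x : EuclideanSpace ℝ (Fin 2)) (ρ : ℝ), perimeterIn E (Metric.ball x ρ) < ⊤

/-- `E` has variational curvature bounded above by the constant `h`. -/
def HasVarCurvLE (E : Set (EuclideanSpace ℝ (Fin 2))) (h : ℝ) : Prop :=
  ∃ r₀ > 0, ∀ (x₀ : EuclideanSpace ℝ (Fin 2)) (ρ : ℝ), 0 < ρ → ρ < r₀ →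
    ∀ F : Set (EuclideanSpace ℝ (Fin 2)), MeasurableSet F → F ⊆ E →
      closure (symmDiff F E) ⊆ Metric.ball x₀ ρ → IsCompact (closure (symmDiff F E)) →
      perimeterIn E (Metric.ball x₀ ρ) ≤
        perimeterIn F (Metric.ball x₀ ρ) + ENNReal.ofReal h * volume (E \ F)

/-- The Euclidean plane. -/
abbrev Plane := EuclideanSpace ℝ (Fin 2)

lemma vdiv_congr_nhds {φ ψ : Plane → Plane} {z : Plane} (hh : φ =ᶠ[nhds z] ψ) :
    vdiv φ z = vdiv ψ z := by
  unfold vdiv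
  rw [hh.fderiv_eq]

lemma vdiv_eq_of_hasFDerivAt {φ : Plane → Plane} {L : Plane →L[ℝ] Plane} {z : Plane}
    (hh : HasFDerivAt φ L z) :
    vdiv φ z = L (EuclideanSpace.single 0 1) 0 + L (EuclideanSpace.single 1 1) 1 := by
  unfold vdiv
  rw [hh.fderiv, Fin.sum_univ_two]

lemma clm_apply_plane (L : Plane →L[ℝ] ℝ) (v : Plane) :
    L v = v 0 * L (EuclideanSpace.single 0 1) + v 1 * L (EuclideanSpace.single 1 1) := by
  have hv : v = v 0 • EuclideanSpace.single 0 (1 : ℝ) + v 1 • EuclideanSpace.single 1 (1 : ℝ) := by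
    ext i
    fin_cases i <;> simp
  conv_lhs => rw [hv]
  simp

lemma vdiv_add {φ ψ : Plane → Plane} {z : Plane} (h1 : DifferentiableAt ℝ φ z)
    (h2 : DifferentiableAt ℝ ψ z) :
    vdiv (fun w => φ w + ψ w) z = vdiv φ z + vdiv ψ z := by
  rw [vdiv_eq_of_hasFDerivAt (φ := fun w => φ w + ψ w) (h1.hasFDerivAt.add h2.hasFDerivAt),
    vdiv_eq_of_hasFDerivAt h1.hasFDerivAt, vdiv_eq_of_hasFDerivAt h2.hasFDerivAt]
  simp
  ring

lemma vdiv_smul {f : Plane → ℝ} {f' : Plane →L[ℝ] ℝ} {φ : Plane → Plane} {z : Plane}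
    (hf : HasFDerivAt f f' z) (h1 : DifferentiableAt ℝ φ z) :
    vdiv (fun w => f w • φ w) z = f z * vdiv φ z + f' (φ z) := by
  rw [vdiv_eq_of_hasFDerivAt (φ := fun w => f w • φ w) (hf.smul h1.hasFDerivAt), vdiv_eq_of_hasFDerivAt h1.hasFDerivAt,
    clm_apply_plane f' (φ z)]
  simp
  ring

lemma vdiv_sub_const (p z : Plane) : vdiv (fun w => w - p) z = 2 := by
  rw [vdiv_eq_of_hasFDerivAt (φ := fun w => w - p) ((hasFDerivAt_id z).sub_const p)]
  simp
  norm_num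

lemma hasFDerivAt_radial {k : ℝ → ℝ} {k' : ℝ} (p z : Plane)
    (hk : HasDerivAt k k' (‖z - p‖ ^ 2)) :
    HasFDerivAt (fun w : Plane => k (‖w - p‖ ^ 2)) (k' • ((2 : ℝ) • innerSL ℝ (z - p))) z := by
  have h1 : HasFDerivAt (fun w : Plane => ‖w - p‖ ^ 2) ((2 : ℝ) • innerSL ℝ (z - p)) z := by
    have := ((hasFDerivAt_id z).sub_const p).norm_sq
    refine this.congr_fderiv ?_
    ext v
    simp
  exact hk.comp_hasFDerivAt z h1

lemma vdiv_mix {η : ℝ → ℝ} {η' : ℝ} {φ : Plane → Plane} {p z : Plane}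
    (hη : HasDerivAt η η' (‖z - p‖ ^ 2)) (hφ : DifferentiableAt ℝ φ z) (hz : 0 < ‖z - p‖) :
    vdiv (fun w => (1 - η (‖w - p‖ ^ 2)) • φ w +
        (η (‖w - p‖ ^ 2) * (√(‖w - p‖ ^ 2))⁻¹) • (w - p)) z =
      (1 - η (‖z - p‖ ^ 2)) * vdiv φ z + η (‖z - p‖ ^ 2) * ‖z - p‖⁻¹ +
        2 * η' * (‖z - p‖ - inner ℝ (z - p) (φ z)) := by
  have hs : (‖z - p‖ ^ 2) ≠ 0 := by positivity
  have hk1 : HasDerivAt (fun s => 1 - η s) (-η') (‖z - p‖ ^ 2) := hη.const_sub 1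
  have hk2 := hη.mul ((Real.hasDerivAt_sqrt hs).inv (by positivity))
  have e1 := hasFDerivAt_radial p z hk1
  have e2 := hasFDerivAt_radial p z hk2
  have hid : DifferentiableAt ℝ (fun w : Plane => w - p) z := by fun_prop
  have e3 := vdiv_add (e1.differentiableAt.smul hφ) (e2.differentiableAt.smul hid)
  have e4 := vdiv_smul e1 hφ
  have e5 := vdiv_smul e2 hid
  refine e3.trans ?_
  refine (congrArg₂ (· + ·) e4 e5).trans ?_
  rw [vdiv_sub_const]
  simp only [smul_apply, innerSL_apply_apply, smul_eq_mul, Pi.mul_apply,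
    Pi.inv_apply, real_inner_self_eq_norm_sq]
  rw [Real.sqrt_sq hz.le]
  field_simp
  ring

/-- Smooth cutoff equal to `1` on `[S, ∞)` and to `0` on `(-∞, S - 1/n]`. -/
noncomputable def cutoff (S n s : ℝ) : ℝ := Real.smoothTransition (1 + n * (s - S))

lemma cutoff_nonneg (S n s : ℝ) : 0 ≤ cutoff S n s := Real.smoothTransition.nonneg _

lemma cutoff_le_one (S n s : ℝ) : cutoff S n s ≤ 1 := Real.smoothTransition.le_one _

lemma cutoff_contDiff (S n : ℝ) : ContDiff ℝ 1 (cutoff S n) := by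
  unfold cutoff
  exact (Real.smoothTransition.contDiff (n := 1)).comp (by fun_prop)

lemma cutoff_mono (S : ℝ) {n : ℝ} (hn : 0 ≤ n) : Monotone (cutoff S n) := by
  intro a b hab
  exact Real.smoothTransition.monotone (by gcongr)

lemma cutoff_eq_zero {S n s : ℝ} (hn : 0 < n) (hs : s ≤ S - 1 / n) : cutoff S n s = 0 := by
  apply Real.smoothTransition.zero_of_nonpos
  have : n * (s - S) ≤ n * (-(1 / n)) := by
    apply mul_le_mul_of_nonneg_left _ hn.le
    linarith
  have h2 : n * (-(1 / n)) = -1 := by field_simp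
  linarith

lemma cutoff_eq_one {S n s : ℝ} (hn : 0 < n) (hs : S ≤ s) : cutoff S n s = 1 := by
  apply Real.smoothTransition.one_of_one_le
  have : 0 ≤ n * (s - S) := mul_nonneg hn.le (by linarith)
  linarith

lemma exists_competitor {E : Set Plane} {x p : Plane} {r S s₀ P n : ℝ} (hr : 0 < r)
    (hs₀ : 0 < s₀) (hn : 0 < n) (hnS : s₀ ≤ S - 1 / n)
    (hE1 : ∀ z ∈ E, z ∈ ball x r → ‖z - p‖ ≤ P)
    (hE2 : ∀ z ∈ E, z ∈ ball x r → s₀ ≤ ‖z - p‖ ^ 2 → z ∈ ball x (r / 2))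
    {φ : Plane → Plane} (hφ : ContDiff ℝ 1 φ) (hφc : HasCompactSupport φ)
    (hφs : tsupport φ ⊆ ball x r) (hφ1 : ∀ z, ‖φ z‖ ≤ 1) :
    ∃ ψ : Plane → Plane, ContDiff ℝ 1 ψ ∧ HasCompactSupport ψ ∧ tsupport ψ ⊆ ball x r ∧
      (∀ z, ‖ψ z‖ ≤ 1) ∧ ∀ z ∈ E, (1 - cutoff S n (‖z - p‖ ^ 2)) * vdiv φ z +
        cutoff S n (‖z - p‖ ^ 2) * (ball x r).indicator (fun _ => P⁻¹) z ≤ vdiv ψ z := by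
  let χ : ContDiffBump x := ⟨r / 2, 3 * r / 4, by positivity, by linarith⟩
  set η : ℝ → ℝ := cutoff S n with hη
  set ψ₁ : Plane → Plane := fun w => (1 - η (‖w - p‖ ^ 2)) • φ w with hψ₁
  set ψ₂ : Plane → Plane := fun w =>
    χ w • ((η (‖w - p‖ ^ 2) * (√(‖w - p‖ ^ 2))⁻¹) • (w - p)) with hψ₂
  have hsq : ContDiff ℝ 1 (fun w : Plane => ‖w - p‖ ^ 2) :=
    (contDiff_id.sub contDiff_const).norm_sq ℝ
  have hηc : ContDiff ℝ 1 (fun w : Plane => η (‖w - p‖ ^ 2)) := (cutoff_contDiff S n).comp hsq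
  have hzero : ∀ w : Plane, ‖w - p‖ ^ 2 < s₀ → η (‖w - p‖ ^ 2) = 0 := fun w hw =>
    cutoff_eq_zero hn (by linarith)
  have hopen : ∀ z : Plane, ‖z - p‖ ^ 2 < s₀ → ∀ᶠ w in nhds z, ‖w - p‖ ^ 2 < s₀ := fun z hz =>
    hsq.continuous.continuousAt.eventually_lt continuousAt_const hz
  have hts1 : tsupport ψ₁ ⊆ tsupport φ := tsupport_smul_subset_right _ _
  have hts2 : tsupport ψ₂ ⊆ closedBall x (3 * r / 4) := by
    refine (tsupport_smul_subset_left _ _).trans ?_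
    rw [χ.tsupport_eq]
  have hts : tsupport (fun w => ψ₁ w + ψ₂ w) ⊆ tsupport φ ∪ closedBall x (3 * r / 4) := by
    apply closure_minimal _ ((isClosed_tsupport φ).union isClosed_closedBall)
    intro w hw
    by_contra hcon
    rw [mem_union, not_or] at hcon
    have a1 : ψ₁ w = 0 := image_eq_zero_of_notMem_tsupport (fun hh => hcon.1 (hts1 hh))
    have a2 : ψ₂ w = 0 := image_eq_zero_of_notMem_tsupport (fun hh => hcon.2 (hts2 hh))
    exact hw (by simp [a1, a2])
  have htsb : tsupport (fun w => ψ₁ w + ψ₂ w) ⊆ ball x r :=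
    hts.trans (union_subset hφs (closedBall_subset_ball (by linarith)))
  refine ⟨fun w => ψ₁ w + ψ₂ w, ?_, ?_, htsb, ?_, ?_⟩
  · apply ContDiff.add
    · exact (contDiff_const.sub hηc).smul hφ
    · rw [contDiff_iff_contDiffAt]
      intro z
      by_cases hz : ‖z - p‖ ^ 2 < s₀
      · have : ψ₂ =ᶠ[nhds z] fun _ => 0 := by
          filter_upwards [hopen z hz] with w hw
          simp [hψ₂, hzero w hw]
        exact contDiffAt_const.congr_of_eventuallyEq this
      · have hz' : 0 < ‖z - p‖ ^ 2 := by linarith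
        have i1 : ContDiffAt ℝ 1 (fun w : Plane => (√(‖w - p‖ ^ 2))⁻¹) z :=
          (hsq.contDiffAt.sqrt hz'.ne').inv (Real.sqrt_pos.2 hz').ne'
        exact χ.contDiffAt.smul ((hηc.contDiffAt.mul i1).smul
          (contDiffAt_id.sub contDiffAt_const))
  · exact HasCompactSupport.of_support_subset_isCompact
      (hφc.isCompact.union (isCompact_closedBall x (3 * r / 4)))
      (subset_closure.trans hts)
  · intro z
    have b0 : 0 ≤ η (‖z - p‖ ^ 2) := cutoff_nonneg _ _ _
    have b1 : η (‖z - p‖ ^ 2) ≤ 1 := cutoff_le_one _ _ _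
    have c1 : ‖ψ₁ z‖ ≤ 1 - η (‖z - p‖ ^ 2) := by
      rw [hψ₁]
      simp only [norm_smul, Real.norm_eq_abs]
      rw [abs_of_nonneg (by linarith)]
      exact mul_le_of_le_one_right (by linarith) (hφ1 z)
    have c2 : ‖ψ₂ z‖ ≤ η (‖z - p‖ ^ 2) := by
      rw [hψ₂]
      simp only [norm_smul, Real.norm_eq_abs, abs_mul, abs_inv]
      rw [abs_of_nonneg b0, abs_of_nonneg χ.nonneg, Real.sqrt_sq (norm_nonneg _), abs_norm]
      have d1 : ‖z - p‖⁻¹ * ‖z - p‖ ≤ 1 := inv_mul_le_one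
      calc χ z * (η (‖z - p‖ ^ 2) * ‖z - p‖⁻¹ * ‖z - p‖)
          = χ z * (η (‖z - p‖ ^ 2) * (‖z - p‖⁻¹ * ‖z - p‖)) := by ring
        _ ≤ 1 * (η (‖z - p‖ ^ 2) * 1) := by
            gcongr
            exact χ.le_one
        _ = _ := by ring
    exact (norm_add_le _ _).trans (by linarith)
  · intro z hz
    by_cases hzb : z ∈ ball x r
    · rw [indicator_of_mem hzb]
      by_cases hzs : ‖z - p‖ ^ 2 < s₀
      · have : (fun w => ψ₁ w + ψ₂ w) =ᶠ[nhds z] φ := by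
          filter_upwards [hopen z hzs] with w hw
          simp [hψ₂, hψ₁, hzero w hw]
        rw [vdiv_congr_nhds this, hzero z hzs]
        simp
      · push Not at hzs
        have hpos : 0 < ‖z - p‖ := by
          by_contra hcon
          have : ‖z - p‖ = 0 := le_antisymm (not_lt.1 hcon) (norm_nonneg _)
          rw [this] at hzs
          norm_num at hzs
          linarith
        have hzh := hE2 z hz hzb hzs
        have : (fun w => ψ₁ w + ψ₂ w) =ᶠ[nhds z] fun w => (1 - η (‖w - p‖ ^ 2)) • φ w +
            (η (‖w - p‖ ^ 2) * (√(‖w - p‖ ^ 2))⁻¹) • (w - p) := by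
          filter_upwards [χ.eventuallyEq_one_of_mem_ball hzh] with w hw
          simp [hψ₂, hψ₁, hw]
        have hd : DifferentiableAt ℝ η (‖z - p‖ ^ 2) :=
          (cutoff_contDiff S n).differentiable one_ne_zero _
        rw [vdiv_congr_nhds this,
          vdiv_mix hd.hasDerivAt (hφ.differentiable one_ne_zero z) hpos]
        have g1 : 0 ≤ deriv η (‖z - p‖ ^ 2) := (cutoff_mono S hn.le).deriv_nonneg
        have g2 : inner ℝ (z - p) (φ z) ≤ ‖z - p‖ :=
          (real_inner_le_norm _ _).trans (mul_le_of_le_one_right (norm_nonneg _) (hφ1 z))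
        have g3 : P⁻¹ ≤ ‖z - p‖⁻¹ := inv_anti₀ hpos (hE1 z hz hzb)
        have g4 := mul_le_mul_of_nonneg_left g3 (cutoff_nonneg S n (‖z - p‖ ^ 2))
        have g5 : 0 ≤ 2 * deriv η (‖z - p‖ ^ 2) * (‖z - p‖ - inner ℝ (z - p) (φ z)) :=
          mul_nonneg (by positivity) (by linarith)
        linarith
    · rw [indicator_of_notMem hzb]
      have k1 : vdiv φ z = 0 := by
        have := image_eq_zero_of_notMem_tsupport
          (fun hh => hzb (hφs (tsupport_fderiv_subset ℝ (f := φ) hh)))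
        simp [vdiv, this]
      have k2 : vdiv (fun w => ψ₁ w + ψ₂ w) z = 0 := by
        have := image_eq_zero_of_notMem_tsupport
          (fun hh => hzb (htsb (tsupport_fderiv_subset ℝ (f := fun w => ψ₁ w + ψ₂ w) hh)))
        simp [vdiv, this]
      rw [k1, k2]
      simp

lemma vdiv_eq_zero_of_notMem {φ : Plane → Plane} {z : Plane} (hz : z ∉ tsupport φ) :
    vdiv φ z = 0 := by
  have := image_eq_zero_of_notMem_tsupport
    (fun hh => hz (tsupport_fderiv_subset ℝ (f := φ) hh))
  simp [vdiv, this]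

lemma vdiv_continuous {φ : Plane → Plane} (hφ : ContDiff ℝ 1 φ) : Continuous (vdiv φ) := by
  have := hφ.continuous_fderiv one_ne_zero
  unfold vdiv
  fun_prop

lemma vdiv_integrable {φ : Plane → Plane} (hφ : ContDiff ℝ 1 φ) (hφc : HasCompactSupport φ) :
    Integrable (vdiv φ) := by
  refine (vdiv_continuous hφ).integrable_of_hasCompactSupport ?_
  refine HasCompactSupport.of_support_subset_isCompact hφc.isCompact ?_
  intro z hz
  by_contra hcon
  exact hz (vdiv_eq_zero_of_notMem hcon)

lemma le_perimeterIn {E A : Set Plane} {φ : Plane → Plane} (hφ : ContDiff ℝ 1 φ)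
    (hφc : HasCompactSupport φ) (hφs : tsupport φ ⊆ A) (hφ1 : ∀ z, ‖φ z‖ ≤ 1) :
    ENNReal.ofReal (∫ x in E, vdiv φ x) ≤ perimeterIn E A := by
  unfold perimeterIn
  exact le_iSup_of_le φ (le_iSup_of_le hφ (le_iSup_of_le hφc (le_iSup_of_le hφs
    (le_iSup_of_le hφ1 le_rfl))))

lemma limit_inequality {E : Set Plane} {x p : Plane} {r S s₀ P : ℝ} (hEm : MeasurableSet E)
    (hr : 0 < r) (hP : 0 < P)
    (hs₀ : 0 < s₀) (hS : s₀ < S)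
    (hE1 : ∀ z ∈ E, z ∈ ball x r → ‖z - p‖ ≤ P)
    (hE2 : ∀ z ∈ E, z ∈ ball x r → s₀ ≤ ‖z - p‖ ^ 2 → z ∈ ball x (r / 2))
    (hfin : perimeterIn E (ball x r) < ⊤)
    {D : Set Plane} (hD : D = {z | z ∈ E ∧ z ∈ ball x r ∧ S ≤ ‖z - p‖ ^ 2})
    (hDm : MeasurableSet D)
    {φ : Plane → Plane} (hφ : ContDiff ℝ 1 φ) (hφc : HasCompactSupport φ)
    (hφs : tsupport φ ⊆ ball x r) (hφ1 : ∀ z, ‖φ z‖ ≤ 1) :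
    (∫ z in E \ D, vdiv φ z) + P⁻¹ * (volume D).toReal ≤ (perimeterIn E (ball x r)).toReal := by
  have hDE : D ⊆ E := by
    rw [hD]
    exact fun z hz => hz.1
  have hDb : D ⊆ ball x r := by
    rw [hD]
    exact fun z hz => hz.2.1
  have hDfin : volume D ≠ ⊤ := ((measure_mono hDb).trans_lt measure_ball_lt_top).ne
  have hφi := vdiv_integrable hφ hφc
  have hbi : Integrable ((ball x r).indicator (fun _ : Plane => P⁻¹)) volume :=
    (integrable_indicator_iff measurableSet_ball).2
      (integrableOn_const measure_ball_lt_top.ne)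
  have hDi : Integrable (D.indicator (fun _ : Plane => P⁻¹)) volume :=
    (integrable_indicator_iff hDm).2 (integrableOn_const hDfin)
  let g : ℕ → Plane → ℝ := fun n z => (1 - cutoff S n (‖z - p‖ ^ 2)) * vdiv φ z +
        cutoff S n (‖z - p‖ ^ 2) * (ball x r).indicator (fun _ => P⁻¹) z
  have hcm : ∀ n : ℕ, Continuous (fun z : Plane => cutoff S n (‖z - p‖ ^ 2)) := fun n =>
    (cutoff_contDiff S n).continuous.comp (by fun_prop)
  have hgm : ∀ n, AEStronglyMeasurable (g n) volume := fun n =>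
    ((((continuous_const.sub (hcm n)).mul (vdiv_continuous hφ)).aestronglyMeasurable).add
      ((hcm n).aestronglyMeasurable.mul hbi.aestronglyMeasurable))
  have hgb : ∀ n z, ‖g n z‖ ≤ ‖vdiv φ z‖ + ‖(ball x r).indicator (fun _ => P⁻¹) z‖ := by
    intro n z
    have b0 := cutoff_nonneg S n (‖z - p‖ ^ 2)
    have b1 := cutoff_le_one S n (‖z - p‖ ^ 2)
    refine (norm_add_le _ _).trans ?_
    rw [norm_mul, norm_mul]
    refine add_le_add (mul_le_of_le_one_left (norm_nonneg _) ?_)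
      (mul_le_of_le_one_left (norm_nonneg _) ?_)
    · rw [Real.norm_eq_abs, abs_le]
      constructor <;> linarith
    · rw [Real.norm_eq_abs, abs_le]
      constructor <;> linarith
  have hbound : Integrable (fun z => ‖vdiv φ z‖ + ‖(ball x r).indicator (fun _ => P⁻¹) z‖) volume :=
    hφi.norm.add hbi.norm
  have hgi : ∀ n, Integrable (g n) volume := fun n =>
    hbound.mono' (hgm n) (Filter.Eventually.of_forall (hgb n))
  have hlim : Filter.Tendsto (fun n => ∫ z in E, g n z) Filter.atTop
      (nhds (∫ z in E, ((E \ D).indicator (vdiv φ) z + D.indicator (fun _ => P⁻¹) z))) := by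
    refine tendsto_integral_of_dominated_convergence _ (fun n => (hgm n).restrict)
      hbound.integrableOn (fun n => Filter.Eventually.of_forall (hgb n)) ?_
    rw [ae_restrict_iff' hEm]
    refine Filter.Eventually.of_forall fun z hz => ?_
    apply tendsto_const_nhds.congr'
    by_cases hzS : S ≤ ‖z - p‖ ^ 2
    · filter_upwards [Filter.eventually_gt_atTop 0] with n hn
      have hn' : (0 : ℝ) < n := by exact_mod_cast hn
      have hc := cutoff_eq_one hn' hzS
      by_cases hzb : z ∈ ball x r
      · have hzD : z ∈ D := by
          rw [hD]
          exact ⟨hz, hzb, hzS⟩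
        simp only [g]
        rw [hc, indicator_of_mem hzb, indicator_of_mem hzD,
          indicator_of_notMem (fun hh => hh.2 hzD)]
        ring
      · have hzD : z ∉ D := fun hh => hzb (hDb hh)
        have k1 := vdiv_eq_zero_of_notMem (fun hh => hzb (hφs hh))
        simp only [g]
        rw [hc, indicator_of_notMem hzb, indicator_of_notMem hzD,
          indicator_of_mem (show z ∈ E \ D from ⟨hz, hzD⟩), k1]
        ring
    · have hzD : z ∉ D := by
        rw [hD]
        exact fun hh => hzS hh.2.2
      push Not at hzS
      obtain ⟨N, hN⟩ := exists_nat_one_div_lt (sub_pos.2 hzS)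
      filter_upwards [Filter.eventually_ge_atTop (N + 1)] with n hn
      have hn' : (N : ℝ) + 1 ≤ n := by exact_mod_cast hn
      have hN0 : (0 : ℝ) < (N : ℝ) + 1 := by positivity
      have hle := one_div_le_one_div_of_le hN0 hn'
      have hc : cutoff S n (‖z - p‖ ^ 2) = 0 :=
        cutoff_eq_zero (by linarith) (by linarith)
      simp only [g]
      rw [hc, indicator_of_notMem hzD, indicator_of_mem (show z ∈ E \ D from ⟨hz, hzD⟩)]
      ring
  have hval : (∫ z in E, ((E \ D).indicator (vdiv φ) z + D.indicator (fun _ => P⁻¹) z)) =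
      (∫ z in E \ D, vdiv φ z) + P⁻¹ * (volume D).toReal := by
    rw [integral_add ((hφi.indicator (hEm.diff hDm)).integrableOn) hDi.integrableOn,
      setIntegral_indicator (hEm.diff hDm), setIntegral_indicator hDm,
      inter_eq_right.2 sdiff_subset, inter_eq_right.2 hDE, setIntegral_const]
    simp [Measure.real, mul_comm]
  rw [← hval]
  refine le_of_tendsto hlim ?_
  obtain ⟨N, hN⟩ := exists_nat_one_div_lt (sub_pos.2 hS)
  filter_upwards [Filter.eventually_ge_atTop (N + 1)] with n hn
  have hn' : (N : ℝ) + 1 ≤ n := by exact_mod_cast hn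
  have hN0 : (0 : ℝ) < (N : ℝ) + 1 := by positivity
  have hle := one_div_le_one_div_of_le hN0 hn'
  obtain ⟨ψ, q1, q2, q3, q4, q5⟩ := exists_competitor (S := S) (n := n) hr hs₀ (by linarith)
    (by linarith) hE1 hE2 hφ hφc hφs hφ1
  calc (∫ z in E, g n z) ≤ ∫ z in E, vdiv ψ z :=
        setIntegral_mono_on (hgi n).integrableOn (vdiv_integrable q1 q2).integrableOn hEm q5
    _ ≤ _ := (ENNReal.ofReal_le_iff_le_toReal hfin.ne).1 (le_perimeterIn q1 q2 q3 q4)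

theorem viscosity_of_variational_curvature_bound (E : Set (EuclideanSpace ℝ (Fin 2)))
    (h : ℝ) (hpos : 0 < h) (hEm : MeasurableSet E) (hper : HasLocFinitePerimeter E)
    -- normalization: the topological boundary coincides with the closure of the reduced
    -- boundary, i.e. with the set of points around which both `E` and its complement
    -- have positive measure
    (hnorm : frontier E = {x | ∀ ρ > 0, 0 < volume (E ∩ Metric.ball x ρ) ∧
      0 < volume (Metric.ball x ρ \ E)})
    (hvar : HasVarCurvLE E h) :
    ∀ x ∈ frontier E, ViscCurvLEAt E h x := by
  rintro x hx y ρ hρ hxy ⟨ε, hε, hEε⟩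
  by_contra hcon
  push Not at hcon
  obtain ⟨r₀, hr₀, hv⟩ := hvar
  have hρh : ρ * h < 1 := by rwa [lt_div_iff₀ hpos] at hcon
  -- a slightly larger radius `P = t * ρ`
  obtain ⟨P, hP1, hP2⟩ := exists_between hcon
  have hP : 0 < P := hρ.trans hP1
  set t : ℝ := P / ρ with ht
  have ht1 : 1 < t := (one_lt_div hρ).2 hP1
  have htρ : t * ρ = P := div_mul_cancel₀ P hρ.ne'
  set p : Plane := x + t • (y - x) with hp
  have hyx : ‖y - x‖ = ρ := by
    rw [mem_sphere_iff_norm] at hxy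
    rw [norm_sub_rev, hxy]
  have hxp : ‖x - p‖ ^ 2 = P ^ 2 := by
    rw [hp, sub_add_cancel_left, norm_neg, norm_smul, hyx, Real.norm_eq_abs,
      abs_of_pos (by linarith), htρ]
  have hgeom : ∀ z ∈ closedBall y ρ, ‖z - p‖ ^ 2 ≤ P ^ 2 - (t - 1) * ‖z - x‖ ^ 2 := by
    intro z hz
    rw [mem_closedBall_iff_norm] at hz
    have e1 : ‖z - y‖ ^ 2 ≤ ρ ^ 2 := by gcongr
    have e2 : z - y = (z - x) - (y - x) := by abel
    have e3 : z - p = (z - x) - t • (y - x) := by rw [hp]; abel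
    rw [e2, norm_sub_sq_real, hyx] at e1
    rw [e3, norm_sub_sq_real, norm_smul, hyx, Real.norm_eq_abs, abs_of_pos (by linarith), htρ,
      real_inner_smul_right]
    nlinarith
  set r : ℝ := min (r₀ / 2) (min ε ρ) with hr
  have hr0 : 0 < r := by positivity
  have hrr : r < r₀ := (min_le_left _ _).trans_lt (by linarith)
  have hrε : r ≤ ε := (min_le_right _ _).trans (min_le_left _ _)
  have hrρ : r ≤ ρ := (min_le_right _ _).trans (min_le_right _ _)
  have hEb : ∀ z ∈ E, z ∈ ball x r → ‖z - p‖ ^ 2 ≤ P ^ 2 - (t - 1) * ‖z - x‖ ^ 2 :=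
    fun z hz hzb => hgeom z (hEε ⟨hz, ball_subset_ball hrε hzb⟩)
  have hκ : 0 < (t - 1) * r ^ 2 := mul_pos (by linarith) (by positivity)
  have hs₀ : 0 < P ^ 2 - (t - 1) * r ^ 2 / 8 := by
    have : (t - 1) * r ^ 2 ≤ (t - 1) * ρ ^ 2 := by
      apply mul_le_mul_of_nonneg_left _ (by linarith)
      gcongr
    have h2 : (t - 1) * ρ ^ 2 < t ^ 2 * ρ ^ 2 := by
      apply mul_lt_mul_of_pos_right _ (by positivity)
      nlinarith
    have h3 : t ^ 2 * ρ ^ 2 = P ^ 2 := by rw [← htρ]; ring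
    linarith
  have hS : P ^ 2 - (t - 1) * r ^ 2 / 8 < P ^ 2 - (t - 1) * r ^ 2 / 16 := by linarith
  have hE1 : ∀ z ∈ E, z ∈ ball x r → ‖z - p‖ ≤ P := by
    intro z hz hzb
    have h1 := hEb z hz hzb
    have h2 : 0 ≤ (t - 1) * ‖z - x‖ ^ 2 := mul_nonneg (by linarith) (by positivity)
    exact le_of_sq_le_sq (by linarith) hP.le
  have hE2 : ∀ z ∈ E, z ∈ ball x r → P ^ 2 - (t - 1) * r ^ 2 / 8 ≤ ‖z - p‖ ^ 2 →
      z ∈ ball x (r / 2) := by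
    intro z hz hzb hzs
    have h1 := hEb z hz hzb
    have h2 : (t - 1) * ‖z - x‖ ^ 2 ≤ (t - 1) * (r ^ 2 / 8) := by linarith
    have h3 : ‖z - x‖ ^ 2 ≤ r ^ 2 / 8 := le_of_mul_le_mul_left h2 (by linarith)
    rw [mem_ball_iff_norm]
    refine lt_of_pow_lt_pow_left₀ 2 (by positivity) ?_
    nlinarith
  set S : ℝ := P ^ 2 - (t - 1) * r ^ 2 / 16 with hSdef
  set D : Set Plane := {z | z ∈ E ∧ z ∈ ball x r ∧ S ≤ ‖z - p‖ ^ 2} with hD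
  have hcn : Continuous (fun z : Plane => ‖z - p‖ ^ 2) := by fun_prop
  have hDm : MeasurableSet D :=
    hEm.inter (measurableSet_ball.inter (isClosed_le continuous_const hcn).measurableSet)
  have hDE : D ⊆ E := fun z hz => hz.1
  have hDb : D ⊆ ball x (r / 2) := fun z hz => hE2 z hz.1 hz.2.1 (hS.le.trans hz.2.2)
  have hDfin : volume D ≠ ⊤ := ((measure_mono hDb).trans_lt measure_ball_lt_top).ne
  have hDpos : 0 < volume D := by
    have hnear : ∀ᶠ z in nhds x, S < ‖z - p‖ ^ 2 ∧ z ∈ ball x r := by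
      refine Filter.Eventually.and ?_ (ball_mem_nhds x hr0)
      refine continuousAt_const.eventually_lt hcn.continuousAt ?_
      rw [hxp]
      linarith
    obtain ⟨τ, hτ, hτs⟩ := Metric.eventually_nhds_iff_ball.1 hnear
    have hx' := hx
    rw [hnorm] at hx'
    refine (hx' τ hτ).1.trans_le (measure_mono ?_)
    intro z hz
    exact ⟨hz.1, (hτs z hz.2).2, (hτs z hz.2).1.le⟩
  have hsymm : symmDiff (E \ D) E = D := by
    rw [Set.symmDiff_def]
    ext z
    simp only [mem_union, mem_sdiff]
    constructor
    · rintro (⟨⟨a, b⟩, c⟩ | ⟨a, b⟩)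
      · exact absurd a c
      · by_contra hcc
        exact b ⟨a, hcc⟩
    · intro hz
      exact Or.inr ⟨hDE hz, fun hh => hh.2 hz⟩
  have hcl : closure D ⊆ closedBall x (r / 2) :=
    closure_minimal (hDb.trans ball_subset_closedBall) isClosed_closedBall
  have hineq := hv x r hr0 hrr (E \ D) (hEm.diff hDm) sdiff_subset
    (by
      rw [hsymm]
      exact hcl.trans (closedBall_subset_ball (by linarith)))
    (by
      rw [hsymm]
      exact (isCompact_closedBall x (r / 2)).of_isClosed_subset isClosed_closure hcl)
  rw [sdiff_sdiff_cancel_left hDE] at hineq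
  have hfin := hper x r
  set M : ℝ := (perimeterIn E (ball x r)).toReal with hM
  have key : ∀ φ : Plane → Plane, ContDiff ℝ 1 φ → HasCompactSupport φ → tsupport φ ⊆ ball x r →
      (∀ z, ‖φ z‖ ≤ 1) →
      (∫ z in E \ D, vdiv φ z) + P⁻¹ * (volume D).toReal ≤ M :=
    fun φ a b c d => limit_inequality hEm hr0 hP hs₀ hS hE1 hE2 hfin hD hDm a b c d
  have hPF : perimeterIn (E \ D) (ball x r) ≤ ENNReal.ofReal (M - P⁻¹ * (volume D).toReal) := by
    unfold perimeterIn
    refine iSup_le fun φ => iSup_le fun a => iSup_le fun b => iSup_le fun c => iSup_le fun d => ?_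
    apply ENNReal.ofReal_le_ofReal
    linarith [key φ a b c d]
  have hM0 : P⁻¹ * (volume D).toReal ≤ M := by
    have := key (fun _ => 0) contDiff_const HasCompactSupport.zero (by simp [tsupport]) (by simp)
    simpa [vdiv] using this
  have hdpos : 0 < (volume D).toReal := ENNReal.toReal_pos hDpos.ne' hDfin
  have hfinal : ENNReal.ofReal M ≤
      ENNReal.ofReal (M - P⁻¹ * (volume D).toReal + h * (volume D).toReal) := by
    rw [ENNReal.ofReal_add (by linarith) (by positivity), ENNReal.ofReal_mul hpos.le,
      ENNReal.ofReal_toReal hDfin, hM, ENNReal.ofReal_toReal hfin.ne]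
    exact hineq.trans (add_le_add hPF le_rfl)
  rw [ENNReal.ofReal_le_ofReal_iff
    (add_nonneg (by linarith) (by positivity))] at hfinal
  have hPh : h < P⁻¹ := by
    rw [lt_inv_comm₀ hpos hP, ← one_div]
    exact hP2
  nlinarith
end

section
/- Let Ω ⊂ ℝ² be open, bounded and connected, and let E be a Cheeger set of Ω. Then the area of E is bounded from below by |E| ≥ π·(2/h(Ω))² = 4π/h(Ω)². -/
open MeasureTheory Metric Set ENNReal

noncomputable def perimeter (E : Set (EuclideanSpace ℝ (Fin 2))) : ℝ≥0∞ :=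
  perimeterIn E Set.univ

noncomputable def cheegerConst (Ω : Set (EuclideanSpace ℝ (Fin 2))) : ℝ≥0∞ :=
  ⨅ (F : Set (EuclideanSpace ℝ (Fin 2))) (_ : MeasurableSet F) (_ : F ⊆ Ω)
    (_ : 0 < volume F), perimeter F / volume F

def IsCheegerSet (Ω E : Set (EuclideanSpace ℝ (Fin 2))) : Prop :=
  MeasurableSet E ∧ E ⊆ Ω ∧ 0 < volume E ∧ perimeter E / volume E = cheegerConst Ω


theorem param_int_contDiff (F : (ℝ × ℝ) × ℝ → ℝ) (hF : ContDiff ℝ 1 F) :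
    ContDiff ℝ 1 (fun p : ℝ × ℝ => ∫ t in (0:ℝ)..1, F (p, t)) := by
  set F' : (ℝ × ℝ) → ℝ → ((ℝ × ℝ) →L[ℝ] ℝ) := fun p t =>
    (fderiv ℝ F (p, t)).comp (ContinuousLinearMap.inl ℝ (ℝ × ℝ) ℝ) with hF'
  have hc : Continuous (Function.uncurry F') := by
    have h1 := hF.continuous_fderiv (by simp)
    simp only [hF', Function.uncurry_def]
    exact (h1.comp (by fun_prop)).clm_comp continuous_const
  have hd : ∀ p t, HasFDerivAt (fun q => F (q, t)) (F' p t) p := fun p t =>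
    ((hF.differentiable (by simp)) (p, t)).hasFDerivAt.comp p (hasFDerivAt_prodMk_left p t)
  rw [contDiff_one_iff_hasFDerivAt]
  refine ⟨fun p => ∫ t in (0:ℝ)..1, F' p t, ?_, ?_⟩
  · exact intervalIntegral.continuous_parametric_intervalIntegral_of_continuous' hc 0 1
  · intro p
    obtain ⟨C, hC⟩ := ((isCompact_closedBall p 1).prod (isCompact_Icc (a := (0:ℝ)) (b := 1))).exists_bound_of_continuousOn hc.continuousOn
    refine intervalIntegral.hasFDerivAt_integral_of_dominated_of_fderiv_le (bound := fun _ => C)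
      (Metric.closedBall_mem_nhds p one_pos) ?_ ?_ ?_ ?_ ?_ ?_
    · refine Filter.Eventually.of_forall fun q => ?_
      exact (hF.continuous.comp (by fun_prop : Continuous fun t : ℝ => (q, t))).aestronglyMeasurable
    · exact (hF.continuous.comp (by fun_prop : Continuous fun t : ℝ => (p, t))).intervalIntegrable _ _
    · exact (hc.comp (by fun_prop : Continuous fun t : ℝ => (p, t))).aestronglyMeasurable
    · refine Filter.Eventually.of_forall fun t ht q hq => hC (q, t) ⟨hq, ?_⟩
      rw [uIoc_of_le zero_le_one] at ht
      exact ⟨ht.1.le, ht.2⟩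
    · exact intervalIntegrable_const
    · exact Filter.Eventually.of_forall fun t ht q hq => hd q t

theorem H_contDiff (u : ℝ × ℝ → ℝ) (hu : ContDiff ℝ 1 u) (R : ℝ) :
    ContDiff ℝ 1 (fun p : ℝ × ℝ => ∫ s in (-R)..p.2, u (p.1, s)) := by
  have h := param_int_contDiff (fun q => u (q.1.1, -R + (q.1.2 + R) * q.2)) (by fun_prop)
  have h2 : (fun p : ℝ × ℝ => ∫ s in (-R)..p.2, u (p.1, s)) = fun p : ℝ × ℝ =>
      (p.2 + R) * ∫ t in (0:ℝ)..1, u (p.1, -R + (p.2 + R) * t) := by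
    funext p
    rw [intervalIntegral.mul_integral_comp_add_mul (f := fun s => u (p.1, s))]
    simp
  rw [h2]
  exact ContDiff.mul (by fun_prop) h

noncomputable def Bf (t : ℝ) : ℝ := t + Real.sin t * Real.cos t

theorem Bf_deriv (t : ℝ) : HasDerivAt Bf (2 * Real.cos t ^ 2) t := by
  have := (hasDerivAt_id t).add ((Real.hasDerivAt_sin t).mul (Real.hasDerivAt_cos t))
  refine this.congr_deriv ?_
  have := Real.sin_sq_add_cos_sq t
  linear_combination -this

theorem Bf_contDiff : ContDiff ℝ 1 Bf := by
  unfold Bf; exact contDiff_id.add (Real.contDiff_sin.mul Real.contDiff_cos)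

theorem Bf_strictMono : StrictMono Bf := by
  intro a b hab
  have h1 : Bf b - Bf a = (b - a) + Real.sin (b - a) * Real.cos (b + a) := by
    unfold Bf
    rw [Real.sin_sub, Real.cos_add]
    have h1 := Real.sin_sq_add_cos_sq a
    have h2 := Real.sin_sq_add_cos_sq b
    linear_combination (-Real.sin b * Real.cos b) * h1 + (Real.sin a * Real.cos a) * h2
  have h2 : |Real.sin (b - a)| < |b - a| := Real.abs_sin_lt_abs (by linarith)
  have h3 : |Real.sin (b - a) * Real.cos (b + a)| ≤ |Real.sin (b - a)| := by
    rw [abs_mul]; exact mul_le_of_le_one_right (abs_nonneg _) (Real.abs_cos_le_one _)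
  rw [abs_of_pos (by linarith : 0 < b - a)] at h2
  have := neg_abs_le (Real.sin (b - a) * Real.cos (b + a))
  linarith

theorem Bf_surj : Function.Surjective Bf := by
  have hb : ∀ t, |Real.sin t * Real.cos t| ≤ 1 := fun t => by
    rw [abs_mul]
    exact mul_le_one₀ (Real.abs_sin_le_one _) (abs_nonneg _) (Real.abs_cos_le_one _)
  refine Bf_contDiff.continuous.surjective ?_ ?_
  · refine Filter.tendsto_atTop_mono (f := fun t => t - 1) (fun t => ?_) (Filter.tendsto_atTop_add_const_right _ (-1) Filter.tendsto_id)
    have := neg_le_of_abs_le (hb t); unfold Bf; linarith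
  · refine Filter.tendsto_atBot_mono (f := fun t : ℝ => t + 1) (fun t => ?_) (Filter.tendsto_atBot_add_const_right _ (1:ℝ) Filter.tendsto_id)
    have := le_of_abs_le (hb t); unfold Bf; linarith

noncomputable def Bo : ℝ ≃o ℝ := StrictMono.orderIsoOfSurjective Bf Bf_strictMono Bf_surj

theorem Bo_symm_apply (x : ℝ) : Bf (Bo.symm x) = x := Bo.apply_symm_apply x

theorem Bo_symm_contDiffAt (x : ℝ) (h : Real.cos (Bo.symm x) ≠ 0) :
    ContDiffAt ℝ 1 Bo.symm x :=
  Bo.toHomeomorph.toOpenPartialHomeomorph.contDiffAt_symm_deriv (f₀' := 2 * Real.cos (Bo.symm x) ^ 2)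
    (by positivity) (by simp) (Bf_deriv _) Bf_contDiff.contDiffAt

theorem Bo_symm_deriv (x : ℝ) (h : Real.cos (Bo.symm x) ≠ 0) :
    HasDerivAt Bo.symm (2 * Real.cos (Bo.symm x) ^ 2)⁻¹ x :=
  HasDerivAt.of_local_left_inverse Bo.symm.continuous.continuousAt (Bf_deriv _) (by positivity)
    (Filter.Eventually.of_forall Bo_symm_apply)

theorem Bo_symm_range (x : ℝ) (h1 : -(Real.pi/2) < x) (h2 : x < Real.pi/2) :
    0 < Real.cos (Bo.symm x) := by
  apply Real.cos_pos_of_mem_Ioo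
  constructor
  · rw [OrderIso.lt_symm_apply]
    show Bf _ < x
    unfold Bf; simp; linarith
  · rw [OrderIso.symm_apply_lt]
    show x < Bf _
    unfold Bf; simp; linarith

theorem knothe (u : ℝ × ℝ → ℝ) (hu : ContDiff ℝ 1 u) (hpos : ∀ p, 0 < u p) (R : ℝ)
    (hI : ∫ x in (-R)..R, ∫ y in (-R)..R, u (x, y) = Real.pi) :
    ∃ (a : ℝ → ℝ) (b : ℝ × ℝ → ℝ), ∀ x y : ℝ, |x| < R → |y| < R →
      ContDiffAt ℝ 1 a x ∧ ContDiffAt ℝ 1 b (x, y) ∧ a x ^ 2 + b (x, y) ^ 2 ≤ 1 ∧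
      ∃ a' b' : ℝ, HasDerivAt a a' x ∧ HasDerivAt (fun t => b (x, t)) b' y ∧
        2 * √(u (x, y)) ≤ a' + b' := by
  set H : ℝ × ℝ → ℝ := fun p => ∫ s in (-R)..p.2, u (p.1, s) with hH
  have hHc : ContDiff ℝ 1 H := H_contDiff u hu R
  set g : ℝ → ℝ := fun x => H (x, R) with hg
  have hgc : ContDiff ℝ 1 g := hHc.comp (by fun_prop)
  set M : ℝ → ℝ := fun x => ∫ s in (-R)..x, g s with hM
  have hMd : ∀ x, HasDerivAt M (g x) x := fun x =>
    intervalIntegral.integral_hasDerivAt_right (hgc.continuous.intervalIntegrable _ _)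
      (hgc.continuous.stronglyMeasurableAtFilter _ _) hgc.continuous.continuousAt
  have hMc : ContDiff ℝ 1 M := by
    rw [contDiff_one_iff_deriv]
    refine ⟨fun x => (hMd x).differentiableAt, ?_⟩
    rw [show deriv M = g from funext fun x => (hMd x).deriv]
    exact hgc.continuous
  have hMR : M R = Real.pi := hI
  have hM0 : M (-R) = 0 := by simp [hM]
  have huc : ∀ x, Continuous fun s => u (x, s) := fun x => hu.continuous.comp (by fun_prop)
  have hHy : ∀ x y, HasDerivAt (fun t => H (x, t)) (u (x, y)) y := fun x y =>
    intervalIntegral.integral_hasDerivAt_right ((huc x).intervalIntegrable _ _)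
      ((huc x).stronglyMeasurableAtFilter _ _) (huc x).continuousAt
  have hHmono : ∀ x, StrictMono fun t => H (x, t) := fun x =>
    strictMono_of_hasDerivAt_pos (hHy x) fun t => hpos _
  have hH0 : ∀ x, H (x, -R) = 0 := fun x => by simp [hH]
  set θ : ℝ → ℝ := fun x => Bo.symm (M x - Real.pi / 2) with hθ
  refine ⟨fun x => Real.sin (θ x), fun p => Real.cos (θ p.1) * (-1 + 2 * (H p / g p.1)), ?_⟩
  intro x y hx hy
  rw [abs_lt] at hx hy
  have hgpos : ∀ x, 0 < g x := fun x => by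
    have := hHmono x (by linarith : -R < R)
    simp only [hH0] at this
    exact this
  have hMmono : StrictMono M := strictMono_of_hasDerivAt_pos hMd hgpos
  have hcos : 0 < Real.cos (θ x) := by
    apply Bo_symm_range
    · have := hMmono hx.1; linarith
    · have := hMmono hx.2; linarith
  have hθc : ContDiffAt ℝ 1 θ x :=
    ContDiffAt.comp x (Bo_symm_contDiffAt _ hcos.ne') (hMc.contDiffAt.sub contDiffAt_const)
  have hθd : HasDerivAt θ ((2 * Real.cos (θ x) ^ 2)⁻¹ * g x) x :=
    HasDerivAt.comp x (Bo_symm_deriv _ hcos.ne') ((hMd x).sub_const _)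
  have hq0 : 0 < H (x, y) := by
    have := hHmono x hy.1
    simp only [hH0] at this
    exact this
  have hq1 : H (x, y) < g x := hHmono x hy.2
  have hgx := hgpos x
  refine ⟨Real.contDiff_sin.contDiffAt.comp x hθc, ?_, ?_, Real.cos (θ x) * ((2 * Real.cos (θ x) ^ 2)⁻¹ * g x),
    Real.cos (θ x) * (2 * (u (x, y) / g x)), ?_, ?_, ?_⟩
  · have h1 : ContDiffAt ℝ 1 (fun p : ℝ × ℝ => θ p.1) (x, y) :=
      ContDiffAt.comp (x, y) (g := θ) hθc contDiffAt_fst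
    have h2 : ContDiffAt ℝ 1 (fun p : ℝ × ℝ => g p.1) (x, y) :=
      ContDiffAt.comp (x, y) (g := g) hgc.contDiffAt contDiffAt_fst
    refine (Real.contDiff_cos.contDiffAt.comp (x, y) h1).mul
      (contDiffAt_const.add (contDiffAt_const.mul (hHc.contDiffAt.div h2 hgx.ne')))
  · have hr0 : 0 < H (x, y) / g x := div_pos hq0 hgx
    have hr1 : H (x, y) / g x < 1 := (div_lt_one hgx).2 hq1
    have hs := Real.sin_sq_add_cos_sq (θ x)
    simp only
    set r := H (x, y) / g x
    have : (-1 + 2 * r) ^ 2 ≤ 1 := by nlinarith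
    rw [mul_pow]
    nlinarith [sq_nonneg (Real.cos (θ x))]
  · exact hθd.sin
  · exact ((((hHy x y).div_const (g x)).const_mul 2).const_add (-1)).const_mul (Real.cos (θ x))
  · have hu0 := hpos (x, y)
    set c := Real.cos (θ x)
    set G := u (x, y)
    have e1 : c * ((2 * c ^ 2)⁻¹ * g x) = g x / (2 * c) := by field_simp
    have e2 : c * (2 * (G / g x)) = 2 * c * G / g x := by ring
    rw [e1, e2]
    have h3 : 0 < g x / (2 * c) := by positivity
    have h4 : 0 < 2 * c * G / g x := by positivity
    have h5 : g x / (2 * c) * (2 * c * G / g x) = G := by field_simp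
    have h6 : √G ^ 2 = G := Real.sq_sqrt hu0.le
    refine le_of_sq_le_sq ?_ (by positivity)
    nlinarith [sq_nonneg (g x / (2 * c) - 2 * c * G / g x)]

theorem perim_lower (E : Set (EuclideanSpace ℝ (Fin 2))) (hE : MeasurableSet E) (r : ℝ)
    (hr : 0 < r) (hEr : E ⊆ ball 0 r) (u : EuclideanSpace ℝ (Fin 2) → ℝ)
    (hu : ContDiff ℝ 1 u) (hpos : ∀ p, 0 < u p)
    (hI : ∫ x in (-(3 * r))..(3 * r), ∫ y in (-(3 * r))..(3 * r), u (!₂[x, y]) = Real.pi) :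
    ENNReal.ofReal (∫ x in E, 2 * √(u x)) ≤ perimeter E := by
  have hmk : ContDiff ℝ 1 (fun p : ℝ × ℝ => (!₂[p.1, p.2] : EuclideanSpace ℝ (Fin 2))) := by
    rw [contDiff_euclidean]
    intro i
    fin_cases i
    · exact contDiff_fst
    · exact contDiff_snd
  have hpair : ContDiff ℝ 1 (fun z : EuclideanSpace ℝ (Fin 2) => (z 0, z 1)) := by fun_prop
  obtain ⟨a, b, hab⟩ := knothe (fun p => u (!₂[p.1, p.2])) (hu.comp hmk) (fun p => hpos _) (3 * r) hI
  let χ : ContDiffBump (0 : EuclideanSpace ℝ (Fin 2)) := ⟨r, 2 * r, hr, by linarith⟩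
  have hcoord : ∀ (z : EuclideanSpace ℝ (Fin 2)) (i : Fin 2), |z i| ≤ ‖z‖ := fun z i =>
    PiLp.norm_apply_le z i
  have hz : ∀ z : EuclideanSpace ℝ (Fin 2), !₂[z 0, z 1] = z := fun z => by
    ext i; fin_cases i <;> rfl
  let T : EuclideanSpace ℝ (Fin 2) → EuclideanSpace ℝ (Fin 2) := fun z => !₂[a (z 0), b (z 0, z 1)]
  let φ : EuclideanSpace ℝ (Fin 2) → EuclideanSpace ℝ (Fin 2) := fun z => χ z • T z
  have hTc : ∀ z : EuclideanSpace ℝ (Fin 2), ‖z‖ ≤ 2 * r → ContDiffAt ℝ 1 T z := by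
    intro z hzr
    obtain ⟨h1, h2, -⟩ := hab (z 0) (z 1) (by linarith [hcoord z 0]) (by linarith [hcoord z 1])
    rw [contDiffAt_euclidean]
    intro i
    fin_cases i
    · exact ContDiffAt.comp z (g := a) (f := fun z : EuclideanSpace ℝ (Fin 2) => z 0) h1 (by fun_prop)
    · exact ContDiffAt.comp z (g := b) (f := fun z : EuclideanSpace ℝ (Fin 2) => (z 0, z 1)) h2 hpair.contDiffAt
  have hts : tsupport χ = closedBall 0 (2 * r) := χ.tsupport_eq
  have hφc : ContDiff ℝ 1 φ := by
    rw [contDiff_iff_contDiffAt]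
    intro z
    by_cases h : z ∈ tsupport χ
    · refine χ.contDiff.contDiffAt.smul (hTc z ?_)
      rw [hts] at h
      simpa using h
    · have : φ =ᶠ[nhds z] fun _ => 0 := by
        filter_upwards [notMem_tsupport_iff_eventuallyEq.1 h] with w hw
        simp [φ, hw]
      exact contDiffAt_const.congr_of_eventuallyEq this
  have hφs : HasCompactSupport φ := χ.hasCompactSupport.smul_right
  have hφn : ∀ z, ‖φ z‖ ≤ 1 := by
    intro z
    by_cases h : z ∈ tsupport χ
    · rw [hts] at h
      have h' : ‖z‖ ≤ 2 * r := by simpa using h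
      obtain ⟨-, -, h3, -⟩ := hab (z 0) (z 1) (by linarith [hcoord z 0]) (by linarith [hcoord z 1])
      have hT : ‖T z‖ ≤ 1 := by
        rw [EuclideanSpace.norm_eq, Real.sqrt_le_one]
        simpa [T, Fin.sum_univ_two] using h3
      rw [norm_smul, Real.norm_of_nonneg χ.nonneg]
      exact mul_le_one₀ χ.le_one (norm_nonneg _) hT
    · simp [φ, image_eq_zero_of_notMem_tsupport h]
  have hdiv : ∀ z ∈ E, 2 * √(u z) ≤ vdiv φ z := by
    intro z hzE
    have hzr : z ∈ ball (0 : EuclideanSpace ℝ (Fin 2)) r := hEr hzE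
    have hzn : ‖z‖ < r := by simpa using hzr
    obtain ⟨h1, h2, h3, a', b', ha, hb, hle⟩ :=
      hab (z 0) (z 1) (by linarith [hcoord z 0]) (by linarith [hcoord z 1])
    simp only [hz] at hle
    refine hle.trans (le_of_eq ?_)
    have heq : φ =ᶠ[nhds z] T := by
      filter_upwards [χ.eventuallyEq_one_of_mem_ball hzr] with w hw
      simp [φ, hw]
    have hTd : HasFDerivAt T (fderiv ℝ T z) z :=
      ((hTc z (by linarith)).differentiableAt (by simp)).hasFDerivAt
    have key : ∀ i : Fin 2, HasDerivAt (fun t : ℝ => T (z + t • EuclideanSpace.single i 1) i)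
        (fderiv ℝ T z (EuclideanSpace.single i 1) i) 0 := by
      intro i
      have := ((EuclideanSpace.proj i : EuclideanSpace ℝ (Fin 2) →L[ℝ] ℝ).hasFDerivAt.comp z hTd)
      have h0 := HasFDerivAt.hasLineDerivAt this (EuclideanSpace.single i 1)
      exact h0
    unfold vdiv
    rw [heq.fderiv_eq, Fin.sum_univ_two]
    congr 1
    · have k := key 0
      have h4 : HasDerivAt (fun t : ℝ => a (z 0 + t)) a' 0 :=
        HasDerivAt.comp_const_add (f := a) (z 0) 0 (by simpa using ha)
      refine h4.unique (k.congr_of_eventuallyEq (Filter.Eventually.of_forall fun t => ?_))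
      simp [T]
    · have k := key 1
      have h4 : HasDerivAt (fun t : ℝ => b (z 0, z 1 + t)) b' 0 :=
        HasDerivAt.comp_const_add (f := fun t => b (z 0, t)) (z 1) 0 (by simpa using hb)
      refine h4.unique (k.congr_of_eventuallyEq (Filter.Eventually.of_forall fun t => ?_))
      simp [T]
  have hvc : Continuous (vdiv φ) := by
    have := hφc.continuous_fderiv (by simp)
    unfold vdiv
    fun_prop
  have hint : ∀ f : EuclideanSpace ℝ (Fin 2) → ℝ, Continuous f → IntegrableOn f E := fun f hf =>
    (hf.continuousOn.integrableOn_compact (isCompact_closedBall 0 r)).mono_set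
      (hEr.trans ball_subset_closedBall)
  calc ENNReal.ofReal (∫ x in E, 2 * √(u x)) ≤ ENNReal.ofReal (∫ x in E, vdiv φ x) := by
        refine ENNReal.ofReal_le_ofReal (setIntegral_mono_on (hint _ ?_) (hint _ hvc) hE hdiv)
        exact continuous_const.mul hu.continuous.sqrt
    _ ≤ perimeter E := by
        unfold perimeter perimeterIn
        exact le_iSup_of_le φ (le_iSup_of_le hφc (le_iSup_of_le hφs (le_iSup_of_le (subset_univ _)
          (le_iSup_of_le hφn le_rfl))))

theorem iter_int_le (w : EuclideanSpace ℝ (Fin 2) → ℝ) (hw : Integrable w) (h0 : ∀ z, 0 ≤ w z)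
    (R : ℝ) (hR : 0 < R) :
    ∫ x in (-R)..R, ∫ y in (-R)..R, w (!₂[x, y]) ≤ ∫ z, w z := by
  have hmp : MeasurePreserving (fun p : ℝ × ℝ => (!₂[p.1, p.2] : EuclideanSpace ℝ (Fin 2))) :=
    (PiLp.volume_preserving_toLp (Fin 2)).comp (volume_preserving_finTwoArrow ℝ).symm
  have hme : MeasurableEmbedding (fun p : ℝ × ℝ => (!₂[p.1, p.2] : EuclideanSpace ℝ (Fin 2))) :=
    (MeasurableEquiv.toLp 2 (Fin 2 → ℝ)).measurableEmbedding.comp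
      (MeasurableEquiv.finTwoArrow (α := ℝ)).symm.measurableEmbedding
  have hi : Integrable (fun p : ℝ × ℝ => w (!₂[p.1, p.2])) := (hmp.integrable_comp_emb hme).2 hw
  have hle : -R ≤ R := by linarith
  simp only [intervalIntegral.integral_of_le hle]
  rw [← hmp.integral_comp hme w]
  have := setIntegral_prod (μ := (volume : Measure ℝ)) (ν := (volume : Measure ℝ)) (s := Ioc (-R) R) (t := Ioc (-R) R)
    (fun p : ℝ × ℝ => w (!₂[p.1, p.2])) hi.integrableOn
  rw [← this]
  exact setIntegral_le_integral hi (Filter.Eventually.of_forall fun p => h0 _)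

theorem iso_eta (E : Set (EuclideanSpace ℝ (Fin 2))) (hE : MeasurableSet E) (r : ℝ)
    (hr : 0 < r) (hEr : E ⊆ ball 0 r) (η : ℝ) (hη : 0 < η) :
    ENNReal.ofReal ((volume.real E - η) * (2 * √(Real.pi / (volume.real E + η + 36 * r ^ 2 * η))))
      ≤ perimeter E := by
  have hEfin : volume E ≠ ⊤ := ((measure_mono hEr).trans_lt measure_ball_lt_top).ne
  obtain ⟨K, hKE, hK, hKv⟩ := hE.exists_isCompact_lt_add hEfin (ε := ENNReal.ofReal η) (by simpa using hη)
  obtain ⟨U', hEU', hU'o, hU'v⟩ := E.exists_isOpen_lt_add hEfin (ε := ENNReal.ofReal η) (by simpa using hη)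
  set U := U' ∩ ball 0 r with hU
  have hEU : E ⊆ U := subset_inter hEU' hEr
  have hUo : IsOpen U := hU'o.inter isOpen_ball
  have hUv : volume U < volume E + ENNReal.ofReal η := (measure_mono inter_subset_left).trans_lt hU'v
  have hUfin : volume U ≠ ⊤ := ((measure_mono inter_subset_right).trans_lt measure_ball_lt_top).ne
  have hKfin : volume K ≠ ⊤ := hK.measure_lt_top.ne
  have hUr : volume.real U ≤ volume.real E + η := by
    have := ENNReal.toReal_mono (by simp [hEfin]) hUv.le
    rwa [ENNReal.toReal_add hEfin (by simp), ENNReal.toReal_ofReal hη.le] at this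
  have hKr : volume.real E - η ≤ volume.real K := by
    have := ENNReal.toReal_mono (by simp [hKfin]) hKv.le
    rw [ENNReal.toReal_add hKfin (by simp), ENNReal.toReal_ofReal hη.le] at this
    exact sub_le_iff_le_add.2 this
  obtain ⟨w, hwc, hwr, hw0, hw1⟩ := exists_contMDiff_zero_iff_one_iff_of_isClosed (n := 1)
    (modelWithCornersSelf ℝ (EuclideanSpace ℝ (Fin 2))) hUo.isClosed_compl hK.isClosed
    (disjoint_compl_left_iff_subset.2 (hKE.trans hEU))
  rw [contMDiff_iff_contDiff] at hwc
  have hwnn : ∀ z, 0 ≤ w z := fun z => (hwr (mem_range_self z)).1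
  have hwle : ∀ z, w z ≤ 1 := fun z => (hwr (mem_range_self z)).2
  have hwi : w = U.indicator w := by
    funext z
    by_cases h : z ∈ U
    · simp [h]
    · simp [h, (hw0 z).1 h]
  have hUint : Integrable (U.indicator (fun _ => (1:ℝ))) :=
    (integrable_indicator_iff hUo.measurableSet).2 (integrableOn_const hUfin)
  have hwU : ∀ z, w z ≤ U.indicator (fun _ => (1:ℝ)) z := fun z => by
    by_cases h : z ∈ U
    · simp [h, hwle]
    · simp [h, (hw0 z).1 h]
  have hwint : Integrable w := hUint.mono' hwc.continuous.aestronglyMeasurable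
    (Filter.Eventually.of_forall fun z => by rw [Real.norm_of_nonneg (hwnn z)]; exact hwU z)
  have hwI : ∫ z, w z ≤ volume.real U := by
    refine (integral_mono hwint hUint hwU).trans (le_of_eq ?_)
    rw [integral_indicator_const _ hUo.measurableSet]; simp
  have hit := iter_int_le w hwint hwnn (3 * r) (by positivity)
  set I0 := ∫ x in (-(3 * r))..(3 * r), ∫ y in (-(3 * r))..(3 * r), w (!₂[x, y]) with hI0
  have hI0nn : 0 ≤ I0 := intervalIntegral.integral_nonneg (by linarith) fun x _ =>
    intervalIntegral.integral_nonneg (by linarith) fun y _ => hwnn _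
  have hmk : Continuous (fun p : ℝ × ℝ => (!₂[p.1, p.2] : EuclideanSpace ℝ (Fin 2))) := by
    fun_prop
  have hwm : Continuous (fun p : ℝ × ℝ => w (!₂[p.1, p.2])) := hwc.continuous.comp hmk
  have hwy : ∀ x, Continuous (fun y : ℝ => w (!₂[x, y])) := fun x =>
    hwm.comp (by fun_prop : Continuous fun y : ℝ => (x, y))
  have hwx : Continuous (fun x : ℝ => ∫ y in (-(3 * r))..(3 * r), w (!₂[x, y])) :=
    intervalIntegral.continuous_parametric_intervalIntegral_of_continuous' hwm _ _
  set I := I0 + 36 * r ^ 2 * η with hI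
  have hIpos : 0 < I := by positivity
  have hcpos : 0 < Real.pi / I := div_pos Real.pi_pos hIpos
  have hP := perim_lower E hE r hr hEr (fun z => Real.pi / I * (w z + η))
    (contDiff_const.mul (hwc.add contDiff_const))
    (fun z => mul_pos hcpos (by linarith [hwnn z])) (by
      simp only [intervalIntegral.integral_const_mul]
      have e1 : ∀ x : ℝ, ∫ y in (-(3 * r))..(3 * r), (w (!₂[x, y]) + η) =
          (∫ y in (-(3 * r))..(3 * r), w (!₂[x, y])) + 6 * r * η := fun x => by
        rw [intervalIntegral.integral_add ((hwy x).intervalIntegrable _ _) intervalIntegrable_const,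
          intervalIntegral.integral_const, smul_eq_mul]
        ring
      simp only [e1]
      rw [intervalIntegral.integral_add (hwx.intervalIntegrable _ _) intervalIntegrable_const, ← hI0]
      have e2 : I0 + ∫ x in (-(3 * r))..(3 * r), 6 * r * η = I := by
        simp [hI]; ring
      rw [e2]
      field_simp)
  refine le_trans (ENNReal.ofReal_le_ofReal ?_) hP
  have hcont : Continuous fun z => 2 * √(Real.pi / I * (w z + η)) :=
    continuous_const.mul (continuous_const.mul (hwc.continuous.add continuous_const)).sqrt
  have hintE : IntegrableOn (fun z => 2 * √(Real.pi / I * (w z + η))) E :=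
    (hcont.continuousOn.integrableOn_compact (isCompact_closedBall 0 r)).mono_set
      (hEr.trans ball_subset_closedBall)
  calc (volume.real E - η) * (2 * √(Real.pi / (volume.real E + η + 36 * r ^ 2 * η)))
      ≤ volume.real K * (2 * √(Real.pi / I)) := by
        have : I ≤ volume.real E + η + 36 * r ^ 2 * η := by linarith
        gcongr
    _ = ∫ z in K, 2 * √(Real.pi / I) := by simp
    _ ≤ ∫ z in K, 2 * √(Real.pi / I * (w z + η)) := by
        refine setIntegral_mono_on (integrableOn_const hKfin) (hintE.mono_set hKE)
          hK.measurableSet fun z hz => ?_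
        have h1 : w z = 1 := (hw1 z).1 hz
        gcongr
        rw [h1]
        exact le_mul_of_one_le_right hcpos.le (by linarith)
    _ ≤ ∫ z in E, 2 * √(Real.pi / I * (w z + η)) :=
        setIntegral_mono_set hintE (Filter.Eventually.of_forall fun z => by positivity)
          (Filter.Eventually.of_forall hKE)

theorem iso_ineq (E : Set (EuclideanSpace ℝ (Fin 2))) (hE : MeasurableSet E) (r : ℝ)
    (hr : 0 < r) (hEr : E ⊆ ball 0 r) (hm : 0 < volume.real E) :
    ENNReal.ofReal (volume.real E * (2 * √(Real.pi / volume.real E))) ≤ perimeter E := by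
  set m := volume.real E with hmdef
  have hc : ContinuousAt (fun η : ℝ => ENNReal.ofReal
      ((m - η) * (2 * √(Real.pi / (m + η + 36 * r ^ 2 * η))))) 0 := by
    refine ENNReal.continuous_ofReal.continuousAt.comp ?_
    have hden : m + 0 + 36 * r ^ 2 * 0 ≠ 0 := by simpa using hm.ne'
    have : ContinuousAt (fun η : ℝ => Real.pi / (m + η + 36 * r ^ 2 * η)) 0 :=
      ContinuousAt.div (by fun_prop) (by fun_prop) hden
    exact ContinuousAt.mul (by fun_prop) (continuousAt_const.mul this.sqrt)
  have ht := hc.tendsto.mono_left (nhdsWithin_le_nhds (s := Ioi 0))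
  simp only [sub_zero, add_zero, mul_zero] at ht
  exact le_of_tendsto ht (eventually_nhdsWithin_of_forall fun η hη => iso_eta E hE r hr hEr η hη)

theorem cheeger_set_area_lower_bound (Ω E : Set (EuclideanSpace ℝ (Fin 2)))
    (hΩo : IsOpen Ω) (hΩb : Bornology.IsBounded Ω) (hΩc : IsConnected Ω)
    (hE : IsCheegerSet Ω E) :
    ENNReal.ofReal (4 * Real.pi) / (cheegerConst Ω) ^ 2 ≤ volume E := by
  obtain ⟨hEm, hEΩ, hE0, hEh⟩ := hE
  obtain ⟨r, hr, hΩr⟩ := hΩb.subset_ball_lt 0 0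
  have hEr : E ⊆ ball 0 r := hEΩ.trans hΩr
  have hEfin : volume E ≠ ⊤ := ((measure_mono hEr).trans_lt measure_ball_lt_top).ne
  have hm : 0 < volume.real E := ENNReal.toReal_pos hE0.ne' hEfin
  have hiso := iso_ineq E hEm r hr hEr hm
  have hV : volume E = ENNReal.ofReal (volume.real E) := (ENNReal.ofReal_toReal hEfin).symm
  rw [← hEh]
  set m := volume.real E with hmdef
  have hq : ENNReal.ofReal (2 * √(Real.pi / m)) ≤ perimeter E / volume E := by
    rw [ENNReal.le_div_iff_mul_le (Or.inl hE0.ne') (Or.inl hEfin), hV,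
      ← ENNReal.ofReal_mul (by positivity), mul_comm]
    exact hiso
  have hs : (2 * √(Real.pi / m)) ^ 2 = 4 * Real.pi / m := by
    rw [mul_pow, Real.sq_sqrt (by positivity)]; ring
  calc ENNReal.ofReal (4 * Real.pi) / (perimeter E / volume E) ^ 2
      ≤ ENNReal.ofReal (4 * Real.pi) / ENNReal.ofReal (2 * √(Real.pi / m)) ^ 2 := by gcongr
    _ = volume E := by
      have hpi := Real.pi_pos
      rw [← ENNReal.ofReal_pow (by positivity), hs, ← ENNReal.ofReal_div_of_pos (by positivity), hV]
      congr 1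
      field_simp
end
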